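/- arXiv:1203.5591 — 3 statements merged into one kernel-verified Lean document; each statement's English description precedes it below -/
import Mathlib

section
/- For any d signed measures (charges) ρ₁,…,ρ_d on ℝ^d, each given by an L¹ density, there exists a (possibly degenerate, i.e. empty or all of ℝ^d) closed halfspace H such that ρᵢ(H) = ρᵢ(ℝ^d)/2 for all i = 1,…,d. -/
open MeasureTheory
open scoped RealInnerProductSpace

namespace BorsukUlam

section Chains

variable {E : Type*}

/-- Augmented ordered chains modulo two: formal sums of lists of points. -/
abbrev Chain (E : Type*) := List E →₀ ZMod 2

/-- The cone over a chain with apex `x`. -/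
noncomputable def cone (x : E) : Chain E →ₗ[ZMod 2] Chain E :=
  Finsupp.lmapDomain (ZMod 2) (ZMod 2) (List.cons x)

/-- The sum of the faces of a list, the face opposite to `x` being weighted by `χ x`. -/
noncomputable def faceSum (χ : E → ZMod 2) : List E → Chain E
  | [] => 0
  | x :: l => χ x • Finsupp.single l 1 + cone x (faceSum χ l)

/-- The weighted boundary operator; the weight `1` gives the usual boundary. -/
noncomputable def bdry (χ : E → ZMod 2) : Chain E →ₗ[ZMod 2] Chain E :=
  Finsupp.linearCombination (ZMod 2) (faceSum χ)

/-- The chain map induced by a map of points. -/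
noncomputable def push (g : E → E) : Chain E →ₗ[ZMod 2] Chain E :=
  Finsupp.lmapDomain (ZMod 2) (ZMod 2) (List.map g)

@[simp] lemma cone_single (x : E) (l : List E) (r : ZMod 2) :
    cone x (Finsupp.single l r) = Finsupp.single (x :: l) r := by
  simp [cone]

@[simp] lemma push_single (g : E → E) (l : List E) (r : ZMod 2) :
    push g (Finsupp.single l r) = Finsupp.single (l.map g) r := by
  simp [push]

@[simp] lemma bdry_single (χ : E → ZMod 2) (l : List E) :
    bdry χ (Finsupp.single l 1) = faceSum χ l := by
  simp [bdry]

lemma chain_add_self (c : Chain E) : c + c = 0 := by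
  ext l
  exact CharTwo.add_self_eq_zero _

lemma linearMap_ext {f g : Chain E →ₗ[ZMod 2] Chain E}
    (h : ∀ l, f (Finsupp.single l 1) = g (Finsupp.single l 1)) : f = g := by
  refine Finsupp.lhom_ext' fun l => LinearMap.ext_ring ?_
  simpa using h l

lemma bdry_cone (χ : E → ZMod 2) (x : E) (c : Chain E) :
    bdry χ (cone x c) = χ x • c + cone x (bdry χ c) := by
  have : bdry χ ∘ₗ cone x = χ x • LinearMap.id + cone x ∘ₗ bdry χ :=
    linearMap_ext fun l => by simp [faceSum]
  exact LinearMap.congr_fun this c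

lemma push_cone (g : E → E) (x : E) (c : Chain E) :
    push g (cone x c) = cone (g x) (push g c) := by
  have : push g ∘ₗ cone x = cone (g x) ∘ₗ push g :=
    linearMap_ext fun l => by simp
  exact LinearMap.congr_fun this c

lemma bdry_comm (χ χ' : E → ZMod 2) (c : Chain E) :
    bdry χ (bdry χ' c) = bdry χ' (bdry χ c) := by
  have : bdry χ ∘ₗ bdry χ' = bdry χ' ∘ₗ bdry χ := by
    refine linearMap_ext fun l => ?_
    simp only [LinearMap.comp_apply, bdry_single]
    induction l with
    | nil => simp [faceSum]
    | cons x l ih =>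
      simp only [faceSum, map_add, map_smul, bdry_single, bdry_cone, ih]
      abel
  exact LinearMap.congr_fun this c

lemma bdry_bdry (χ : E → ZMod 2) (c : Chain E) : bdry χ (bdry χ c) = 0 := by
  have : bdry χ ∘ₗ bdry χ = 0 := by
    refine linearMap_ext fun l => ?_
    simp only [LinearMap.comp_apply, bdry_single, LinearMap.zero_apply]
    induction l with
    | nil => simp [faceSum]
    | cons x l ih =>
      simp only [faceSum, map_add, map_smul, bdry_single, bdry_cone, ih, map_zero, add_zero]
      exact chain_add_self _
  exact LinearMap.congr_fun this c

lemma bdry_add (χ χ' : E → ZMod 2) (c : Chain E) :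
    bdry (χ + χ') c = bdry χ c + bdry χ' c := by
  have : bdry (χ + χ') = bdry χ + bdry χ' := by
    refine linearMap_ext fun l => ?_
    simp only [LinearMap.add_apply, bdry_single]
    induction l with
    | nil => simp [faceSum]
    | cons x l ih =>
      simp only [faceSum, ih, map_add, Pi.add_apply, add_smul]
      abel
  exact LinearMap.congr_fun this c

lemma bdry_zero (c : Chain E) : bdry 0 c = 0 := by
  have h := bdry_add 0 0 c
  simpa using h

lemma bdry_push (χ : E → ZMod 2) (g : E → E) (c : Chain E) :
    bdry χ (push g c) = push g (bdry (χ ∘ g) c) := by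
  have : bdry χ ∘ₗ push g = push g ∘ₗ bdry (χ ∘ g) := by
    refine linearMap_ext fun l => ?_
    simp only [LinearMap.comp_apply, bdry_single, push_single]
    induction l with
    | nil => simp [faceSum]
    | cons x l ih => simp [faceSum, ih, push_cone]
  exact LinearMap.congr_fun this c

lemma faceSum_congr {χ χ' : E → ZMod 2} {l : List E} (h : ∀ x ∈ l, χ x = χ' x) :
    faceSum χ l = faceSum χ' l := by
  induction l with
  | nil => rfl
  | cons x l ih =>
    simp only [List.forall_mem_cons] at h
    simp only [faceSum, h.1, ih h.2]

lemma faceSum_eq_zero {χ : E → ZMod 2} {l : List E} (h : ∀ x ∈ l, χ x = 0) :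
    faceSum χ l = 0 := by
  rw [faceSum_congr (χ' := 0) (by simpa using h), ← bdry_single, bdry_zero]

lemma bdry_faceSum_eq_zero {χ χ' : E → ZMod 2} {l : List E}
    (h : ∀ x ∈ l, ∀ y ∈ l, χ x * χ' y = 0) : bdry χ (faceSum χ' l) = 0 := by
  by_cases hχ : ∀ x ∈ l, χ x = 0
  · rw [← bdry_single, bdry_comm, bdry_single, faceSum_eq_zero hχ, map_zero]
  · push Not at hχ
    obtain ⟨x, hx, hx0⟩ := hχ
    rw [faceSum_eq_zero fun y hy => (mul_eq_zero.1 (h x hx y hy)).resolve_left hx0, map_zero]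

end Chains

section Support

variable {E : Type*}

/-- Chains all of whose lists satisfy `P`. -/
abbrev chainsOn (P : List E → Prop) : Submodule (ZMod 2) (Chain E) :=
  Finsupp.supported (ZMod 2) (ZMod 2) {l | P l}

lemma single_mem_chainsOn {P : List E → Prop} {l : List E} (h : P l) :
    Finsupp.single l 1 ∈ chainsOn P :=
  Finsupp.single_mem_supported _ _ h

lemma chainsOn_induction {P : List E → Prop} {N : Submodule (ZMod 2) (Chain E)}
    (f : Chain E →ₗ[ZMod 2] Chain E) (h : ∀ l, P l → f (Finsupp.single l 1) ∈ N)
    {c : Chain E} (hc : c ∈ chainsOn P) : f c ∈ N := by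
  rw [chainsOn, Finsupp.supported_eq_span_single] at hc
  have : Submodule.span (ZMod 2) ((fun l => Finsupp.single l 1) '' {l | P l}) ≤ N.comap f := by
    rw [Submodule.span_le]
    rintro _ ⟨l, hl, rfl⟩
    exact h l hl
  exact this hc

lemma eqOn_chainsOn {P : List E → Prop} (f g : Chain E →ₗ[ZMod 2] Chain E)
    (h : ∀ l, P l → f (Finsupp.single l 1) = g (Finsupp.single l 1))
    {c : Chain E} (hc : c ∈ chainsOn P) : f c = g c := by
  have := chainsOn_induction (N := ⊥) (f - g)
    (fun l hl => by simp [h l hl]) hc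
  simpa [sub_eq_zero] using this

lemma cone_mem_chainsOn {P Q : List E → Prop} {x : E} (h : ∀ l, P l → Q (x :: l))
    {c : Chain E} (hc : c ∈ chainsOn P) : cone x c ∈ chainsOn Q :=
  chainsOn_induction _ (fun l hl => by
    rw [cone_single]; exact single_mem_chainsOn (h l hl)) hc

lemma chainsOn_mono {P Q : List E → Prop} (h : ∀ l, P l → Q l) : chainsOn P ≤ chainsOn Q :=
  Finsupp.supported_mono h

lemma faceSum_mem (χ : E → ZMod 2) (l : List E) :
    faceSum χ l ∈ chainsOn fun l' => l'.length + 1 = l.length ∧ l' ⊆ l := by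
  induction l with
  | nil => exact zero_mem _
  | cons x l ih =>
    refine add_mem (Submodule.smul_mem _ _ (single_mem_chainsOn ?_)) (cone_mem_chainsOn ?_ ih)
    · simp
    · rintro l' ⟨h1, h2⟩
      exact ⟨by simp [h1], List.cons_subset_cons x h2⟩

end Support

section Fan

variable {E : Type*}

/-- The sum of the iterated weighted boundaries along all alternating sequences of labels
`(j₁, s₁), …, (jₖ, sₖ)` with `j₁ < ⋯ < jₖ < m` and `sₖ = s`. -/
noncomputable def alternating (χ : ℕ → Bool → E → ZMod 2) :
    ℕ → Bool → Chain E →ₗ[ZMod 2] Chain E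
  | 0, _ => LinearMap.id
  | m + 1, s => alternating χ m s + alternating χ m (!s) ∘ₗ bdry (χ m s)

lemma alternating_bdry (χ : ℕ → Bool → E → ZMod 2) (m : ℕ) (s : Bool) (c : Chain E)
    (hc : ∀ j, bdry (χ j true) (bdry (χ j false) c) = 0) :
    alternating χ m s (bdry (∑ j ∈ Finset.range m, (χ j true + χ j false)) c) =
      alternating χ m true c + alternating χ m false c := by
  induction m generalizing s c with
  | zero => simp [alternating, bdry_zero, chain_add_self]
  | succ m ih =>
    have hb : ∀ t j, bdry (χ j true) (bdry (χ j false) (bdry (χ m t) c)) = 0 := by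
      intro t j
      rw [bdry_comm (χ j false), bdry_comm (χ j true), hc, map_zero]
    have e1 : ∀ t, bdry (χ m t) (bdry (χ m (!t)) c) = 0 := by
      intro t
      cases t
      · rw [bdry_comm]; exact hc m
      · exact hc m
    simp only [Finset.sum_range_succ, bdry_add, alternating, LinearMap.add_apply,
      LinearMap.comp_apply, map_add, ih _ c hc]
    rw [bdry_comm (χ m s) (∑ j ∈ Finset.range m, (χ j true + χ j false)), ih _ _ (hb s)]
    have key := chain_add_self (alternating χ m s (bdry (χ m s) c))
    have e := e1 s
    cases s <;>
      simp only [Bool.not_false, Bool.not_true] at e ⊢ <;>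
      rw [e, map_zero] <;>
      simp only [bdry_bdry, map_zero] <;>
      linear_combination (norm := abel) key

lemma alternating_push {χ : ℕ → Bool → E → ZMod 2} {g : E → E}
    (hχ : ∀ j s, χ j s ∘ g = χ j (!s)) (m : ℕ) (s : Bool) (c : Chain E) :
    alternating χ m s (push g c) = push g (alternating χ m (!s) c) := by
  induction m generalizing s c with
  | zero => rfl
  | succ m ih => simp [alternating, ih, bdry_push, hχ]

lemma push_apply_nil (g : E → E) (c : Chain E) : push g c [] = c [] := by
  have : Finsupp.lapply (R := ZMod 2) [] ∘ₗ push g = Finsupp.lapply [] := by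
    refine Finsupp.lhom_ext' fun l => LinearMap.ext_ring ?_
    cases l <;> simp
  exact LinearMap.congr_fun this c

lemma alternating_apply_nil (χ : ℕ → Bool → E → ZMod 2) {m n : ℕ} (h : m < n) (s : Bool)
    {c : Chain E} (hc : c ∈ chainsOn fun l => l.length = n) : alternating χ m s c [] = 0 := by
  induction m generalizing n s c with
  | zero =>
    by_contra h0
    have := hc (Finsupp.mem_support_iff.2 h0)
    simp only [List.length_nil, Set.mem_ofPred_eq] at this
    omega
  | succ m ih =>
    simp only [alternating, LinearMap.add_apply, LinearMap.comp_apply, Finsupp.add_apply]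
    rw [ih (by omega) _ hc, ih (n := n - 1) (by omega), add_zero]
    refine chainsOn_induction _ (fun l hl => ?_) hc
    rw [bdry_single]
    exact chainsOn_mono (fun l' hl' => by omega) (faceSum_mem _ l)

lemma alternating_single_nil (χ : ℕ → Bool → E → ZMod 2) (m : ℕ) (s : Bool) :
    alternating χ m s (Finsupp.single [] 1) = Finsupp.single [] 1 := by
  induction m generalizing s with
  | zero => rfl
  | succ m ih => simp [alternating, ih, faceSum]

/-- A combinatorial form of the lemma of Fan and Tucker: there is no labelling by `m` pairs of
opposite labels without complementary pairs on a system of antipodal chains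
of dimension `m`. -/
theorem no_antipodal_labelling {m : ℕ} {χ : ℕ → Bool → E → ZMod 2} {g : E → E}
    (hχ : ∀ j s, χ j s ∘ g = χ j (!s)) (P : List E → Prop)
    (hlab : ∀ l, P l → ∀ x ∈ l, ∑ j ∈ Finset.range m, (χ j true x + χ j false x) = 1)
    (hcompl : ∀ l, P l → ∀ j, ∀ x ∈ l, ∀ y ∈ l, χ j true x * χ j false y = 0)
    (s h : ℕ → Chain E) (hs0 : s 0 = Finsupp.single [] 1)
    (hs : ∀ n, s (n + 1) = h n + push g (h n)) (hh : ∀ n, bdry 1 (h n) = s n)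
    (hP : ∀ n ≤ m, h n ∈ chainsOn P)
    (hlen : s (m + 1) ∈ chainsOn fun l => l.length = m + 1) : False := by
  have key : ∀ n ≤ m + 1, alternating χ m true (s n) [] = 1 := by
    intro n
    induction n with
    | zero => simp [hs0, alternating_single_nil]
    | succ n ih =>
      intro hn
      rw [← ih (by omega), ← hh n]
      have e : bdry 1 (h n) = bdry (∑ j ∈ Finset.range m, (χ j true + χ j false)) (h n) := by
        refine eqOn_chainsOn _ _ (fun l hl => ?_) (hP n (by omega))
        rw [bdry_single, bdry_single]
        exact faceSum_congr fun x hx => by simpa using (hlab l hl x hx).symm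
      have e2 : ∀ j, bdry (χ j true) (bdry (χ j false) (h n)) = 0 := fun j =>
        eqOn_chainsOn (bdry (χ j true) ∘ₗ bdry (χ j false)) 0 (fun l hl => by
          simpa using bdry_faceSum_eq_zero (hcompl l hl j)) (hP n (by omega))
      rw [e, alternating_bdry _ _ _ _ e2, hs, map_add, alternating_push hχ]
      simp only [Finsupp.add_apply, push_apply_nil, Bool.not_true]
  have h1 := key (m + 1) le_rfl
  rw [alternating_apply_nil χ (Nat.lt_succ_self m) true hlen] at h1
  exact zero_ne_one h1

end Fan
section Subdivision

variable {E : Type*} [NormedAddCommGroup E] [NormedSpace ℝ E]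

/-- The barycenter of a list of points. -/
noncomputable def bary (l : List E) : E := (l.length : ℝ)⁻¹ • l.sum

/-- Barycentric subdivision of the chains formed by lists of length `n`. -/
noncomputable def sd : ℕ → Chain E →ₗ[ZMod 2] Chain E
  | 0 => LinearMap.id
  | n + 1 => Finsupp.linearCombination (ZMod 2) fun l => cone (bary l) (sd n (faceSum 1 l))

lemma sd_succ_single (n : ℕ) (l : List E) :
    sd (n + 1) (Finsupp.single l 1) = cone (bary l) (sd n (faceSum 1 l)) := by
  simp [sd]

lemma bdry_sd (n : ℕ) (c : Chain E) : bdry 1 (sd (n + 1) c) = sd n (bdry 1 c) := by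
  have : bdry 1 ∘ₗ sd (n + 1) = sd n ∘ₗ bdry (1 : E → ZMod 2) := by
    induction n with
    | zero =>
      refine linearMap_ext fun l => ?_
      simp only [LinearMap.comp_apply, sd_succ_single, bdry_cone, bdry_single]
      simp only [sd, LinearMap.id_apply, ← bdry_single, bdry_bdry]
      simp
    | succ n ih =>
      refine linearMap_ext fun l => ?_
      have h := LinearMap.congr_fun ih (faceSum 1 l)
      simp only [LinearMap.comp_apply] at h
      simp only [LinearMap.comp_apply, sd_succ_single n.succ, bdry_cone, bdry_single, h]
      simp only [← bdry_single, bdry_bdry]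
      simp
  exact LinearMap.congr_fun this c

lemma bary_map_neg (l : List E) : bary (l.map Neg.neg) = -bary l := by
  have h : (l.map Neg.neg).sum = -l.sum := by
    induction l with
    | nil => simp
    | cons x l ih => simp [ih, add_comm]
  simp [bary, h]

lemma sd_push_neg (n : ℕ) (c : Chain E) : sd n (push Neg.neg c) = push Neg.neg (sd n c) := by
  have : sd n ∘ₗ push Neg.neg = push Neg.neg ∘ₗ sd (E := E) n := by
    induction n with
    | zero => rfl
    | succ n ih =>
      refine linearMap_ext fun l => ?_
      have h := LinearMap.congr_fun ih (faceSum 1 l)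
      simp only [LinearMap.comp_apply] at h
      simp only [LinearMap.comp_apply, push_single, sd_succ_single, push_cone, bary_map_neg, ← h]
      rw [← bdry_single, ← push_single, bdry_push, bdry_single]
      rfl
  exact LinearMap.congr_fun this c

lemma bary_mem_convexHull {l : List E} (hl : l ≠ []) : bary l ∈ convexHull ℝ {x | x ∈ l} := by
  have h0 : (l.length : ℝ) ≠ 0 := by simpa using hl
  have e : bary l = ∑ i : Fin l.length, (l.length : ℝ)⁻¹ • l[i] := by
    rw [← Finset.smul_sum, bary]
    congr 1
    simp [Fin.sum_univ_getElem]
  rw [e]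
  refine (convex_convexHull ℝ _).sum_mem (fun i _ => by positivity) (by simp [h0]) fun i _ => ?_
  exact subset_convexHull ℝ _ (List.getElem_mem _)

lemma norm_sum_sub_le {l : List E} {v : E} {D : ℝ} (hD : ∀ w ∈ l, ‖w - v‖ ≤ D) :
    ‖l.sum - (l.length : ℝ) • v‖ ≤ l.length * D := by
  induction l with
  | nil => simp
  | cons w l ih =>
    simp only [List.forall_mem_cons] at hD
    have e : (w :: l).sum - ((w :: l).length : ℝ) • v =
        (w - v) + (l.sum - (l.length : ℝ) • v) := by
      simp only [List.sum_cons, List.length_cons]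
      push_cast
      module
    rw [e]
    refine (norm_add_le _ _).trans ?_
    have := ih hD.2
    push_cast [List.length_cons]
    linarith [hD.1]

lemma dist_bary_le {l : List E} {D r : ℝ} (hr : l.length * (1 - r) ≤ 1)
    (hD : ∀ x ∈ l, ∀ y ∈ l, dist x y ≤ D) {v : E} (hv : v ∈ l) : dist (bary l) v ≤ r * D := by
  classical
  have hD0 : 0 ≤ D := dist_nonneg.trans (hD v hv v hv)
  have hp := List.perm_cons_erase hv
  have hlen : (l.length : ℝ) = (l.erase v).length + 1 := by
    rw [hp.length_eq]; push_cast [List.length_cons]; rfl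
  have hpos : (0 : ℝ) < l.length := by rw [hlen]; positivity
  have h1 := norm_sum_sub_le (l := l.erase v) (v := v) (D := D) fun w hw => by
    rw [← dist_eq_norm]
    exact hD w (List.mem_of_mem_erase hw) v hv
  have e : bary l - v = (l.length : ℝ)⁻¹ • ((l.erase v).sum - ((l.erase v).length : ℝ) • v) := by
    rw [eq_inv_smul_iff₀ hpos.ne', smul_sub, bary, smul_inv_smul₀ hpos.ne', hp.sum_eq, hlen,
      List.sum_cons]
    module
  rw [dist_eq_norm, e, norm_smul, norm_inv, Real.norm_of_nonneg hpos.le, inv_mul_le_iff₀ hpos]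
  nlinarith

lemma sd_single_mem {n : ℕ} {r D : ℝ} (hr1 : r ≤ 1) (hr : n * (1 - r) ≤ 1)
    {l : List E} (hl : l.length = n) (hD : ∀ x ∈ l, ∀ y ∈ l, dist x y ≤ D) :
    sd n (Finsupp.single l 1) ∈ chainsOn fun l' => l'.length = n ∧
      (∀ x ∈ l', x ∈ convexHull ℝ {x | x ∈ l}) ∧ ∀ x ∈ l', ∀ y ∈ l', dist x y ≤ r * D := by
  induction n generalizing l with
  | zero =>
    rw [List.length_eq_zero_iff] at hl
    subst hl
    exact single_mem_chainsOn (by simp)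
  | succ n ih =>
    rw [sd_succ_single]
    have hne : l ≠ [] := by rintro rfl; simp at hl
    have hr' : (n : ℝ) * (1 - r) ≤ 1 := by push_cast at hr; nlinarith
    have hdist : ∀ x ∈ convexHull ℝ {x | x ∈ l}, dist x (bary l) ≤ r * D := fun x hx =>
      convexHull_min (t := Metric.closedBall (bary l) (r * D))
        (fun y hy => by
          rw [Metric.mem_closedBall, dist_comm]
          exact dist_bary_le (by rw [hl]; exact hr) hD hy) (convex_closedBall _ _) hx
    have hb := bary_mem_convexHull hne
    refine cone_mem_chainsOn ?_ (chainsOn_induction (sd n) (N := chainsOn fun l' =>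
      l'.length = n ∧ (∀ x ∈ l', x ∈ convexHull ℝ {x | x ∈ l}) ∧
        ∀ x ∈ l', ∀ y ∈ l', dist x y ≤ r * D) (fun l' hl' => ?_) (faceSum_mem 1 l))
    · rintro l' ⟨h1, h2, h3⟩
      refine ⟨by simp [h1], by simpa [hb] using h2, ?_⟩
      simp only [List.forall_mem_cons]
      exact ⟨⟨hdist _ hb, fun y hy => by rw [dist_comm]; exact hdist y (h2 y hy)⟩,
        fun x hx => ⟨hdist x (h2 x hx), h3 x hx⟩⟩
    · refine chainsOn_mono ?_ (ih hr' (by omega)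
        fun x hx y hy => hD x (hl'.2 hx) y (hl'.2 hy))
      rintro l'' ⟨h1, h2, h3⟩
      exact ⟨h1, fun x hx => convexHull_mono (fun y hy => hl'.2 hy) (h2 x hx), h3⟩

/-- Lists of `n` points with mutual distances at most `D` in a common member of `𝒦`. -/
def IsSmall (𝒦 : Set (Set E)) (n : ℕ) (D : ℝ) (l : List E) : Prop :=
  l.length = n ∧ (∃ K ∈ 𝒦, ∀ x ∈ l, x ∈ K) ∧ ∀ x ∈ l, ∀ y ∈ l, dist x y ≤ D

lemma sd_mem {𝒦 : Set (Set E)} (h𝒦 : ∀ K ∈ 𝒦, Convex ℝ K) {n : ℕ} {r D : ℝ} (hr1 : r ≤ 1)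
    (hr : n * (1 - r) ≤ 1) {c : Chain E} (hc : c ∈ chainsOn (IsSmall 𝒦 n D)) :
    sd n c ∈ chainsOn (IsSmall 𝒦 n (r * D)) := by
  refine chainsOn_induction _ ?_ hc
  rintro l ⟨hl, ⟨K, hK, hlK⟩, hD⟩
  refine chainsOn_mono ?_ (sd_single_mem hr1 hr hl hD)
  rintro l' ⟨h1, h2, h3⟩
  exact ⟨h1, ⟨K, hK, fun x hx => convexHull_min hlK (h𝒦 K hK) (h2 x hx)⟩, h3⟩

lemma sd_iterate_mem {𝒦 : Set (Set E)} (h𝒦 : ∀ K ∈ 𝒦, Convex ℝ K) {n : ℕ} {r D : ℝ} (hr1 : r ≤ 1)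
    (hr : n * (1 - r) ≤ 1) {c : Chain E} (hc : c ∈ chainsOn (IsSmall 𝒦 n D)) (N : ℕ) :
    (sd n)^[N] c ∈ chainsOn (IsSmall 𝒦 n (r ^ N * D)) := by
  induction N with
  | zero => simpa using hc
  | succ N ih =>
    rw [Function.iterate_succ_apply', pow_succ', mul_assoc]
    exact sd_mem h𝒦 hr1 hr ih

end Subdivision

section Sphere

variable {d : ℕ}

/-- The `k`-th standard basis vector (zero if there is none). -/
def basisVec (d k : ℕ) : Fin d → ℝ := fun j => if (j : ℕ) = k then 1 else 0

/-- The chain of dimension `n - 1` carried by the boundary of the `n`-dimensional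
cross-polytope. -/
noncomputable def sphere (d : ℕ) : ℕ → Chain (Fin d → ℝ)
  | 0 => Finsupp.single [] 1
  | n + 1 => cone (basisVec d n) (sphere d n) + push Neg.neg (cone (basisVec d n) (sphere d n))

lemma push_neg_push_neg {E : Type*} [AddCommGroup E] (c : Chain E) :
    push Neg.neg (push Neg.neg c) = c := by
  have : push Neg.neg ∘ₗ push Neg.neg = LinearMap.id (M := Chain E) (R := ZMod 2) :=
    linearMap_ext fun l => by simp
  exact LinearMap.congr_fun this c

lemma push_neg_sphere (n : ℕ) : push Neg.neg (sphere d n) = sphere d n := by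
  cases n with
  | zero => simp [sphere]
  | succ n => rw [sphere, map_add, push_neg_push_neg, add_comm]

lemma bdry_sphere (n : ℕ) : bdry 1 (sphere d n) = 0 := by
  induction n with
  | zero => simp [sphere, faceSum]
  | succ n ih =>
    rw [sphere, map_add, bdry_push]
    simp only [Pi.one_comp, bdry_cone, ih, map_zero, add_zero, Pi.one_apply, one_smul,
      push_neg_sphere]
    exact chain_add_self _

lemma bdry_cone_sphere (n : ℕ) : bdry 1 (cone (basisVec d n) (sphere d n)) = sphere d n := by
  rw [bdry_cone, bdry_sphere]
  simp

/-- Lists of `n` points which are, up to signs, among the first `n` basis vectors, no two of them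
being opposite. -/
def IsSigned (d n : ℕ) (l : List (Fin d → ℝ)) : Prop :=
  l.length = n ∧ ∃ ε : ℕ → ℝ, (∀ i, |ε i| = 1) ∧ ∀ x ∈ l, ∃ i < n, x = ε i • basisVec d i

lemma IsSigned.cons {n : ℕ} {l : List (Fin d → ℝ)} (h : IsSigned d n l) {t : ℝ} (ht : |t| = 1) :
    IsSigned d (n + 1) (t • basisVec d n :: l) := by
  obtain ⟨h1, ε, hε, h2⟩ := h
  refine ⟨by simp [h1], Function.update ε n t, fun i => ?_, ?_⟩
  · rcases eq_or_ne i n with rfl | h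
    · simpa using ht
    · simpa [h] using hε i
  · rw [List.forall_mem_cons]
    refine ⟨⟨n, by omega, by simp⟩, fun x hx => ?_⟩
    obtain ⟨i, hi, rfl⟩ := h2 x hx
    exact ⟨i, by omega, by rw [Function.update_of_ne hi.ne]⟩

lemma cone_mem_isSigned {n : ℕ} {c : Chain (Fin d → ℝ)} (hc : c ∈ chainsOn (IsSigned d n)) :
    cone (basisVec d n) c ∈ chainsOn (IsSigned d (n + 1)) :=
  cone_mem_chainsOn (fun l hl => by simpa using hl.cons (t := 1) (by simp)) hc

lemma sphere_mem (n : ℕ) : sphere d n ∈ chainsOn (IsSigned d n) := by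
  induction n with
  | zero => exact single_mem_chainsOn ⟨rfl, 1, by simp⟩
  | succ n ih =>
    rw [sphere, push_cone, push_neg_sphere]
    exact add_mem (cone_mem_isSigned ih)
      (cone_mem_chainsOn (fun l hl => by simpa using hl.cons (t := -1) (by simp)) ih)

/-- The pieces of hyperplanes carrying the facets of the cross-polytope. -/
def facets (d : ℕ) : Set (Set (Fin d → ℝ)) :=
  {K | ∃ ε : ℕ → ℝ, (∀ i, |ε i| = 1) ∧ K = {x | ‖x‖ ≤ 1 ∧ ∑ j : Fin d, ε j * x j = 1}}

lemma convex_of_mem_facets {K : Set (Fin d → ℝ)} (hK : K ∈ facets d) : Convex ℝ K := by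
  obtain ⟨ε, -, rfl⟩ := hK
  have h1 : Convex ℝ {x : Fin d → ℝ | ‖x‖ ≤ 1} := by
    have := convex_closedBall (0 : Fin d → ℝ) 1
    simpa [Metric.closedBall] using this
  refine h1.inter (convex_hyperplane ⟨fun x y => ?_, fun t x => ?_⟩ 1)
  · simp [mul_add, Finset.sum_add_distrib]
  · simp only [Pi.smul_apply, smul_eq_mul, Finset.mul_sum]
    exact Finset.sum_congr rfl fun j _ => by ring

/-- A compact set containing the boundary of the cross-polytope but not the origin. -/
def shell (d : ℕ) : Set (Fin d → ℝ) := {x | ‖x‖ ≤ 1 ∧ 1 ≤ ∑ j, |x j|}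

lemma facets_subset_shell {K : Set (Fin d → ℝ)} (hK : K ∈ facets d) : K ⊆ shell d := by
  obtain ⟨ε, hε, rfl⟩ := hK
  rintro x ⟨h1, h2⟩
  refine ⟨h1, h2.symm.le.trans (Finset.sum_le_sum fun j _ => ?_)⟩
  calc ε j * x j ≤ |ε j * x j| := le_abs_self _
    _ = |x j| := by rw [abs_mul, hε, one_mul]

lemma isCompact_shell : IsCompact (shell d) := by
  have h : IsClosed {x : Fin d → ℝ | 1 ≤ ∑ j, |x j|} :=
    isClosed_le continuous_const (by fun_prop)
  have e : shell d = Metric.closedBall 0 1 ∩ {x | 1 ≤ ∑ j, |x j|} := by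
    ext x; simp [shell]
  rw [e]
  exact (isCompact_closedBall _ _).inter_right h

lemma zero_notMem_shell : (0 : Fin d → ℝ) ∉ shell d := by
  simp [shell]

lemma isSmall_facets {n : ℕ} (hn : n ≤ d) {l : List (Fin d → ℝ)} (h : IsSigned d n l) :
    IsSmall (facets d) n 2 l := by
  obtain ⟨hl, ε, hε, h⟩ := h
  have hnorm : ∀ x ∈ l, ‖x‖ ≤ 1 := by
    intro x hx
    obtain ⟨i, -, rfl⟩ := h x hx
    rw [norm_smul, Real.norm_eq_abs, hε, one_mul, pi_norm_le_iff_of_nonneg zero_le_one]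
    intro j
    unfold basisVec
    split_ifs <;> simp
  refine ⟨hl, ⟨_, ⟨ε, hε, rfl⟩, fun x hx => ⟨hnorm x hx, ?_⟩⟩, fun x hx y hy => ?_⟩
  · obtain ⟨i, hi, rfl⟩ := h x hx
    rw [Finset.sum_eq_single (⟨i, by omega⟩ : Fin d)]
    · simp [basisVec, ← sq, ← sq_abs (ε i), hε]
    · intro j _ hj
      have : (j : ℕ) ≠ i := fun h => hj (Fin.ext h)
      simp [basisVec, this]
    · simp
  · rw [dist_eq_norm]
    linarith [norm_sub_le x y, hnorm x hx, hnorm y hy]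

lemma bdry_iterate_sd {E : Type*} [NormedAddCommGroup E] [NormedSpace ℝ E] (n N : ℕ) (c : Chain E) :
    bdry 1 ((sd (n + 1))^[N] c) = (sd n)^[N] (bdry 1 c) :=
  Function.Semiconj.iterate_right (f := bdry 1) (bdry_sd n) N c

lemma push_iterate_sd {E : Type*} [NormedAddCommGroup E] [NormedSpace ℝ E] (n N : ℕ) (c : Chain E) :
    push Neg.neg ((sd n)^[N] c) = (sd n)^[N] (push Neg.neg c) :=
  Function.Semiconj.iterate_right (f := push Neg.neg) (fun c => (sd_push_neg n c).symm) N c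

/-- There are arbitrarily fine systems of antipodal chains on the cross-polytope. -/
lemma exists_fine_chains (d : ℕ) {η : ℝ} (hη : 0 < η) :
    ∃ s h : ℕ → Chain (Fin (d + 1) → ℝ), s 0 = Finsupp.single [] 1 ∧
      (∀ n, s (n + 1) = h n + push Neg.neg (h n)) ∧ (∀ n, bdry 1 (h n) = s n) ∧
      (∀ n ≤ d, h n ∈ chainsOn fun l => (∀ x ∈ l, x ∈ shell (d + 1)) ∧
        ∀ x ∈ l, ∀ y ∈ l, dist x y < η) ∧
      s (d + 1) ∈ chainsOn fun l => l.length = d + 1 := by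
  set r : ℝ := 1 - 1 / (d + 1) with hr
  have hr1 : r < 1 := by rw [hr]; linarith [show (0 : ℝ) < 1 / (d + 1) by positivity]
  have hrn : ∀ n ≤ d + 1, (n : ℝ) * (1 - r) ≤ 1 := by
    intro n hn
    have : (n : ℝ) ≤ d + 1 := by exact_mod_cast hn
    rw [hr, sub_sub_cancel, mul_one_div]
    exact (div_le_one (by positivity)).2 this
  obtain ⟨N, hN⟩ := exists_pow_lt_of_lt_one (show 0 < η / 2 by positivity) hr1
  have hfine : ∀ n ≤ d + 1, ∀ c ∈ chainsOn (IsSigned (d + 1) n),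
      (sd n)^[N] c ∈ chainsOn (IsSmall (facets (d + 1)) n (r ^ N * 2)) := fun n hn c hc =>
    sd_iterate_mem (fun _ => convex_of_mem_facets) hr1.le (hrn n hn)
      (chainsOn_mono (fun _ => isSmall_facets hn) hc) N
  refine ⟨fun n => (sd n)^[N] (sphere (d + 1) n),
    fun n => (sd (n + 1))^[N] (cone (basisVec (d + 1) n) (sphere (d + 1) n)), ?_, fun n => ?_,
    fun n => ?_, fun n hn => ?_, ?_⟩
  · exact Function.iterate_fixed rfl N
  · beta_reduce
    rw [push_iterate_sd, sphere.eq_2, iterate_map_add]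
  · rw [bdry_iterate_sd, bdry_cone_sphere]
  · refine chainsOn_mono ?_ (hfine (n + 1) (by omega) _ (cone_mem_isSigned (sphere_mem n)))
    rintro l ⟨-, ⟨K, hK, hlK⟩, hD⟩
    exact ⟨fun x hx => facets_subset_shell hK (hlK x hx),
      fun x hx y hy => (hD x hx y hy).trans_lt (by linarith)⟩
  · exact chainsOn_mono (fun l hl => hl.1) (hfine (d + 1) le_rfl _ (sphere_mem _))

end Sphere

section BorsukUlam

/-- The **Borsuk–Ulam theorem**: an odd continuous map from a punctured `(d + 1)`-dimensional space
to a `d`-dimensional one has a zero. -/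
theorem exists_eq_zero_of_odd {d : ℕ} {f : (Fin (d + 1) → ℝ) → Fin d → ℝ}
    (hf : ContinuousOn f {0}ᶜ) (hodd : ∀ x, x ≠ 0 → f (-x) = -f x) : ∃ x ≠ 0, f x = 0 := by
  by_contra! hne
  have hsub : shell (d + 1) ⊆ {0}ᶜ := fun x hx h0 => zero_notMem_shell (h0 ▸ hx)
  have hcont := hf.mono hsub
  obtain ⟨δ, hδ, hδf⟩ : ∃ δ > 0, ∀ x ∈ shell (d + 1), δ ≤ ‖f x‖ := by
    rcases (shell (d + 1)).eq_empty_or_nonempty with h | h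
    · exact ⟨1, one_pos, by simp [h]⟩
    · obtain ⟨x, hx, hmin⟩ := isCompact_shell.exists_isMinOn h hcont.norm
      exact ⟨‖f x‖, norm_pos_iff.2 (hne x (hsub hx)), fun y hy => hmin hy⟩
  obtain ⟨η, hη, hηf⟩ := Metric.uniformContinuousOn_iff.1
    (isCompact_shell.uniformContinuousOn_of_continuous hcont) δ hδ
  classical
  let F : (Fin (d + 1) → ℝ) → ℕ → ℝ := fun x j => if h : j < d ∧ x ≠ 0 then f x ⟨j, h.1⟩ else 0
  have hFneg : ∀ x j, F (-x) j = -F x j := by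
    intro x j
    by_cases h : j < d ∧ x ≠ 0
    · have h' : j < d ∧ -x ≠ 0 := by simpa using h
      simp only [F, dif_pos h, dif_pos h', hodd x h.2, Pi.neg_apply]
    · have h' : ¬ (j < d ∧ -x ≠ 0) := by simpa using h
      simp only [F, dif_neg h, dif_neg h', neg_zero]
  have hFdist : ∀ x ∈ shell (d + 1), ∀ y ∈ shell (d + 1), dist x y < η →
      ∀ j, |F x j - F y j| < δ := by
    intro x hx y hy hxy j
    by_cases h : j < d
    · have e : ∀ z ∈ shell (d + 1), F z j = f z ⟨j, h⟩ := fun z hz => dif_pos ⟨h, hsub hz⟩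
      rw [e x hx, e y hy, ← Real.dist_eq]
      exact (dist_le_pi_dist _ _ _).trans_lt (hηf x hx y hy hxy)
    · simp [F, h, hδ]
  have hFlarge : ∀ x ∈ shell (d + 1), ∃ j, δ ≤ |F x j| := by
    intro x hx
    by_contra! h
    refine (hδf x hx).not_gt ((pi_norm_lt_iff hδ).2 fun j => ?_)
    have := h j
    rwa [show F x j = f x j from dif_pos ⟨j.2, hsub hx⟩] at this
  let lab : (Fin (d + 1) → ℝ) → ℕ := fun x => sInf {j | δ ≤ |F x j|}
  have hlab : ∀ x ∈ shell (d + 1), δ ≤ |F x (lab x)| := fun x hx => Nat.sInf_mem (hFlarge x hx)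
  have hlabneg : ∀ x, lab (-x) = lab x := fun x => by simp only [lab, hFneg, abs_neg]
  let sgn : Bool → ℝ := fun s => if s then 1 else -1
  have hsgn : ∀ s, sgn (!s) = -sgn s := fun s => by cases s <;> simp [sgn]
  let χ : ℕ → Bool → (Fin (d + 1) → ℝ) → ZMod 2 :=
    fun j s x => if lab x = j ∧ 0 < sgn s * F x j then 1 else 0
  obtain ⟨s, h, h0, hs, hh, hsmall, hlen⟩ := exists_fine_chains d hη
  refine no_antipodal_labelling (χ := χ) (fun j s => ?_) _ ?_ ?_ s h h0 hs hh hsmall hlen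
  · funext x
    simp only [χ, Function.comp_apply, hlabneg, hFneg, hsgn, mul_neg, neg_mul]
  · rintro l ⟨hl, -⟩ x hx
    have hx0 := hlab x (hl x hx)
    have hF0 : F x (lab x) ≠ 0 := fun h => by rw [h, abs_zero] at hx0; linarith
    have hd : lab x < d := by
      by_contra hd
      exact hF0 (by simp [F, hd])
    rw [Finset.sum_eq_single_of_mem (lab x) (Finset.mem_range.2 hd)
      fun j _ hj => by simp [χ, hj.symm]]
    rcases hF0.lt_or_gt with h | h
    · simp [χ, sgn, h, h.le]
    · simp [χ, sgn, h, h.le]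
  · rintro l ⟨hl, hD⟩ j x hx y hy
    by_contra hne0
    obtain ⟨h1, h2⟩ := mul_ne_zero_iff.1 hne0
    simp only [χ, ne_eq, ite_eq_right_iff, one_ne_zero, imp_false, not_not, sgn, if_true,
      one_mul, Bool.false_eq_true, if_false, neg_mul, neg_pos] at h1 h2
    have hx1 := hlab x (hl x hx)
    have hy1 := hlab y (hl y hy)
    rw [h1.1, abs_of_pos h1.2] at hx1
    rw [h2.1, abs_of_neg h2.2] at hy1
    have := (abs_lt.1 (hFdist x (hl x hx) y (hl y hy) (hD x hx y hy) j)).2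
    linarith

end BorsukUlam

end BorsukUlam

section HamSandwich

variable {d : ℕ}

/-- The part of a point of `ℝ^(d + 1)` normal to the boundary of the corresponding halfspace. -/
noncomputable def normalVec (x : Fin (d + 1) → ℝ) : EuclideanSpace ℝ (Fin d) :=
  WithLp.toLp 2 fun i => x i.castSucc

/-- The halfspace of `ℝ^d` parameterized by a point of `ℝ^(d + 1)`. -/
def halfspace (x : Fin (d + 1) → ℝ) : Set (EuclideanSpace ℝ (Fin d)) :=
  {y | ⟪normalVec x, y⟫ ≤ x (Fin.last d)}

lemma normalVec_neg (x : Fin (d + 1) → ℝ) : normalVec (-x) = -normalVec x := rfl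

lemma continuous_normalVec : Continuous (normalVec (d := d)) := by
  unfold normalVec
  fun_prop

lemma last_ne_zero {x : Fin (d + 1) → ℝ} (hx : x ≠ 0) (h : normalVec x = 0) :
    x (Fin.last d) ≠ 0 := by
  refine fun h0 => hx (funext fun i => ?_)
  refine Fin.lastCases h0 (fun i => ?_) i
  exact congrArg (fun v : EuclideanSpace ℝ (Fin d) => v i) h

lemma measurableSet_halfspace (x : Fin (d + 1) → ℝ) : MeasurableSet (halfspace x) :=
  (isClosed_le (by fun_prop) continuous_const).measurableSet

lemma ae_inner_ne {x : Fin (d + 1) → ℝ} (hx : x ≠ 0) :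
    ∀ᵐ y : EuclideanSpace ℝ (Fin d), ⟪normalVec x, y⟫ ≠ x (Fin.last d) := by
  by_cases h : normalVec x = 0
  · exact .of_forall fun y => by simpa [h] using (last_ne_zero hx h).symm
  · let S : AffineSubspace ℝ (EuclideanSpace ℝ (Fin d)) :=
      { carrier := {y | ⟪normalVec x, y⟫ = x (Fin.last d)}
        smul_vsub_vadd_mem' := fun c p₁ p₂ p₃ h₁ h₂ h₃ => by
          simp only [Set.mem_ofPred_eq] at h₁ h₂ h₃ ⊢
          simp [inner_add_right, inner_smul_right, inner_sub_right, h₁, h₂, h₃] }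
    have hS : S ≠ ⊤ := by
      intro hS
      have hmem : ∀ y, ⟪normalVec x, y⟫ = x (Fin.last d) := fun y =>
        show y ∈ S from hS ▸ AffineSubspace.mem_top ℝ _ y
      refine h (inner_self_eq_zero (𝕜 := ℝ).1 ?_)
      rw [hmem, ← hmem 0, inner_zero_right]
    have h0 : volume {y | ⟪normalVec x, y⟫ = x (Fin.last d)} = 0 :=
      Measure.addHaar_affineSubspace volume S hS
    simpa [ae_iff] using h0

lemma setIntegral_halfspace_neg {f : EuclideanSpace ℝ (Fin d) → ℝ} (hf : Integrable f)
    {x : Fin (d + 1) → ℝ} (hx : x ≠ 0) :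
    ∫ y in halfspace (-x), f y = (∫ y, f y) - ∫ y in halfspace x, f y := by
  rw [← integral_add_compl (measurableSet_halfspace x) hf, add_sub_cancel_left]
  refine setIntegral_congr_set ?_
  filter_upwards [ae_inner_ne hx] with y hy
  refine propext ?_
  change ⟪normalVec (-x), y⟫ ≤ (-x) (Fin.last d) ↔ ¬ ⟪normalVec x, y⟫ ≤ x (Fin.last d)
  rw [normalVec_neg, inner_neg_left, Pi.neg_apply, neg_le_neg_iff, not_le]
  exact ⟨fun h => lt_of_le_of_ne h hy.symm, le_of_lt⟩

lemma continuousAt_setIntegral_halfspace {f : EuclideanSpace ℝ (Fin d) → ℝ} (hf : Integrable f)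
    {x : Fin (d + 1) → ℝ} (hx : x ≠ 0) :
    ContinuousAt (fun x => ∫ y in halfspace x, f y) x := by
  simp only [← integral_indicator (measurableSet_halfspace _)]
  refine continuousAt_of_dominated (bound := fun y => ‖f y‖)
    (.of_forall fun z => (hf.indicator (measurableSet_halfspace z)).aestronglyMeasurable)
    (.of_forall fun z => .of_forall fun y => norm_indicator_le_norm_self _ _) hf.norm ?_
  filter_upwards [ae_inner_ne hx] with y hy
  have h1 : Continuous fun z : Fin (d + 1) → ℝ => ⟪normalVec z, y⟫ :=
    continuous_normalVec.inner continuous_const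
  have h2 : Continuous fun z : Fin (d + 1) → ℝ => z (Fin.last d) := continuous_apply _
  rcases hy.lt_or_gt with h | h
  · refine continuousAt_const.congr (f := fun _ => f y) ?_
    filter_upwards [h1.continuousAt.eventually_lt h2.continuousAt h] with z hz
    exact (Set.indicator_of_mem (show y ∈ halfspace z from hz.le) f).symm
  · refine continuousAt_const.congr (f := fun _ => (0 : ℝ)) ?_
    filter_upwards [h2.continuousAt.eventually_lt h1.continuousAt h] with z hz
    exact (Set.indicator_of_notMem (show y ∉ halfspace z from hz.not_ge) f).symm

end HamSandwich

/-- Ham sandwich theorem for charges: for any `d` charges on `ℝ^d` given by integrable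
densities `f i`, there is a (possibly degenerate) closed halfspace `H` such that each charge
gives `H` exactly half of its total value. -/
theorem ham_sandwich_for_charges (d : ℕ)
    (f : Fin d → EuclideanSpace ℝ (Fin d) → ℝ)
    (hf : ∀ i, Integrable (f i) volume) :
    ∃ H : Set (EuclideanSpace ℝ (Fin d)),
      (H = ∅ ∨ H = Set.univ ∨
        ∃ (a : EuclideanSpace ℝ (Fin d)) (b : ℝ), a ≠ 0 ∧ H = {x | ⟪a, x⟫ ≤ b}) ∧
      ∀ i, ∫ x in H, f i x = (∫ x, f i x) / 2 := by
  obtain ⟨x, hx, h⟩ := BorsukUlam.exists_eq_zero_of_odd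
    (f := fun x i => (∫ y in halfspace x, f i y) - (∫ y, f i y) / 2)
    (continuousOn_pi.2 fun i x hx =>
      ((continuousAt_setIntegral_halfspace (hf i) hx).sub continuousAt_const).continuousWithinAt)
    (fun x hx => funext fun i => by
      simp only [Pi.neg_apply, setIntegral_halfspace_neg (hf i) hx]
      ring)
  refine ⟨halfspace x, ?_, fun i => sub_eq_zero.1 (congrFun h i)⟩
  by_cases ha : normalVec x = 0
  · rcases le_or_gt 0 (x (Fin.last d)) with hb | hb
    · exact .inr (.inl (Set.eq_univ_of_forall fun y => by simpa [halfspace, ha] using hb))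
    · exact .inl (Set.eq_empty_of_forall_notMem fun y => by simpa [halfspace, ha] using hb)
  · exact .inr (.inr ⟨_, _, ha, rfl⟩)
end

section
/- Let μ₁, …, μ_d be absolutely continuous probability measures on ℝ^d and let p be a point in the convex hull of the union of their supports. Then there exists a closed halfspace H whose boundary hyperplane contains p, such that μ₁(H) = μ₂(H) = ⋯ = μ_d(H). -/
open MeasureTheory
open scoped RealInnerProductSpace

namespace Tucker

variable {n : ℕ}

/-- A signed coordinate direction of `ℤⁿ`. -/
abbrev Dir (n : ℕ) := Fin n × ℤˣ

/-- The opposite direction. -/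
def opp (a : Dir n) : Dir n := (a.1, -a.2)

@[simp] lemma opp_fst (a : Dir n) : (opp a).1 = a.1 := rfl

@[simp] lemma opp_snd (a : Dir n) : (opp a).2 = -a.2 := rfl

@[simp] lemma opp_opp (a : Dir n) : opp (opp a) = a := by simp [opp]

/-- The unit vector in a given direction. -/
def unitVec (a : Dir n) : Fin n → ℤ := Pi.single a.1 (a.2 : ℤ)

@[simp] lemma unitVec_opp (a : Dir n) : unitVec (opp a) = -unitVec a := by
  simp [unitVec, Pi.single_neg]

lemma unitVec_apply_self (a : Dir n) : unitVec a a.1 = a.2 := by simp [unitVec]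

lemma unitVec_apply_of_ne {a : Dir n} {i : Fin n} (h : a.1 ≠ i) : unitVec a i = 0 := by
  simp [unitVec, h.symm]

lemma eq_or_eq_opp {a b : Dir n} (h : a.1 = b.1) : a = b ∨ a = opp b := by
  rcases Int.units_eq_one_or a.2 with ha | ha <;> rcases Int.units_eq_one_or b.2 with hb | hb <;>
    simp [Prod.ext_iff, h, ha, hb]

/-- The total displacement of a list of steps. -/
def disp (l : List (Dir n)) : Fin n → ℤ := (l.map unitVec).sum

@[simp] lemma disp_nil : disp ([] : List (Dir n)) = 0 := rfl

@[simp] lemma disp_cons (a : Dir n) (l : List (Dir n)) : disp (a :: l) = unitVec a + disp l := by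
  simp [disp]

@[simp] lemma disp_append (l r : List (Dir n)) : disp (l ++ r) = disp l + disp r := by
  simp [disp]

@[simp] lemma disp_reverse (l : List (Dir n)) : disp l.reverse = disp l := by
  simp [disp, List.sum_reverse]

@[simp] lemma disp_map_opp (l : List (Dir n)) : disp (l.map opp) = -disp l := by
  induction l with
  | nil => simp
  | cons a l ih => simp [ih]; abel

lemma disp_apply_eq_zero {l : List (Dir n)} {i : Fin n} (h : i ∉ l.map Prod.fst) :
    disp l i = 0 := by
  induction l with
  | nil => simp
  | cons a l ih =>
    simp only [List.map_cons, List.mem_cons, not_or] at h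
    simp [unitVec_apply_of_ne (Ne.symm h.1), ih h.2]

lemma abs_disp_apply_le {l : List (Dir n)} (h : (l.map Prod.fst).Nodup) (i : Fin n) :
    |disp l i| ≤ 1 := by
  induction l with
  | nil => simp
  | cons a l ih =>
    simp only [List.map_cons, List.nodup_cons] at h
    by_cases hi : a.1 = i
    · subst hi
      rcases Int.units_eq_one_or a.2 with ha | ha <;>
        simp [disp_apply_eq_zero h.1, unitVec_apply_self, ha]
    · simpa [unitVec_apply_of_ne hi] using ih h.2

/-- The vertices strictly after `m` on the path starting at `m` with steps `l`. -/
def fwd (m : Fin n → ℤ) : List (Dir n) → List (Fin n → ℤ)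
  | [] => []
  | a :: l => (m + unitVec a) :: fwd (m + unitVec a) l

/-- The vertices strictly before `m` on the path arriving at `m` whose last steps are, from the
last one backwards, the elements of `l`. -/
def bwd (m : Fin n → ℤ) : List (Dir n) → List (Fin n → ℤ)
  | [] => []
  | a :: l => (m - unitVec a) :: bwd (m - unitVec a) l

/-- All vertices of the path starting at `v` with steps `w`. -/
def walk (v : Fin n → ℤ) (w : List (Dir n)) : List (Fin n → ℤ) := v :: fwd v w

/-- The vertices of the simplex with base point `v` and steps `l.reverse ++ r`, except for the
vertex between `l` and `r`. -/
def facet (v : Fin n → ℤ) (l r : List (Dir n)) : List (Fin n → ℤ) :=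
  bwd (v + disp l) l ++ fwd (v + disp l) r

lemma cons_facet_perm (v : Fin n → ℤ) (l r : List (Dir n)) :
    ((v + disp l) :: facet v l r).Perm (walk v (l.reverse ++ r)) := by
  induction l generalizing r with
  | nil => simp [facet, bwd, walk]
  | cons a l ih =>
    have h := ih (a :: r)
    have h1 : v + (unitVec a + disp l) - unitVec a = v + disp l := by abel
    have h2 : v + disp l + unitVec a = v + (unitVec a + disp l) := by abel
    simp only [facet, fwd, h2, List.reverse_cons, List.append_assoc, List.singleton_append,
      disp_cons, bwd, h1] at h ⊢
    refine List.Perm.trans ?_ h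
    refine (List.Perm.swap _ _ _).trans (List.Perm.cons _ ?_)
    exact List.perm_middle.symm

lemma walk_eq_map (v : Fin n → ℤ) (w : List (Dir n)) :
    walk v w = (List.range (w.length + 1)).map fun j => v + disp (w.take j) := by
  induction w generalizing v with
  | nil => simp [walk, fwd]
  | cons a w ih =>
    rw [List.length_cons, List.range_succ_eq_map, List.map_cons, List.map_map]
    have : walk v (a :: w) = v :: walk (v + unitVec a) w := rfl
    rw [this, ih]
    simp [Function.comp_def, add_assoc]

lemma mem_walk {v : Fin n → ℤ} {w : List (Dir n)} {x : Fin n → ℤ} :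
    x ∈ walk v w ↔ ∃ j ≤ w.length, v + disp (w.take j) = x := by
  simp [walk_eq_map]

lemma abs_sub_le_of_mem_walk {v : Fin n → ℤ} {w : List (Dir n)} (hw : (w.map Prod.fst).Nodup)
    {x y : Fin n → ℤ} (hx : x ∈ walk v w) (hy : y ∈ walk v w) (i : Fin n) :
    |x i - y i| ≤ 1 := by
  obtain ⟨j, -, rfl⟩ := mem_walk.1 hx
  obtain ⟨k, -, rfl⟩ := mem_walk.1 hy
  wlog hjk : j ≤ k generalizing j k
  · rw [abs_sub_comm]
    exact this k hy j hx (le_of_not_ge hjk)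
  have h1 : w.take k = w.take j ++ (w.take k).drop j := by
    conv_lhs => rw [← List.take_append_drop j (w.take k)]
    rw [List.take_take, min_eq_left hjk]
  rw [h1, disp_append, abs_sub_comm]
  have h2 : ((w.take k).drop j).Sublist w := (List.drop_sublist _ _).trans (List.take_sublist _ _)
  simpa [add_assoc] using abs_disp_apply_le (hw.sublist (h2.map _)) i

lemma fwd_map_opp (m : Fin n → ℤ) (l : List (Dir n)) :
    fwd (-m) (l.map opp) = (fwd m l).map Neg.neg := by
  induction l generalizing m with
  | nil => simp [fwd]
  | cons a l ih =>
    simp only [List.map_cons, fwd, unitVec_opp]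
    rw [← neg_add, ih]

lemma apply_eq_of_mem_fwd {m x : Fin n → ℤ} {l : List (Dir n)} (hx : x ∈ fwd m l) {i : Fin n}
    (hi : i ∉ l.map Prod.fst) : x i = m i := by
  have : x ∈ walk m l := List.mem_cons_of_mem _ hx
  obtain ⟨j, -, rfl⟩ := mem_walk.1 this
  have : i ∉ (l.take j).map Prod.fst := fun h => hi (((List.take_sublist j l).map _).subset h)
  simp [disp_apply_eq_zero this]

lemma facet_swap (v : Fin n → ℤ) (a b : Dir n) (l r : List (Dir n)) :
    facet v (b :: l) (a :: r) = facet v (a :: l) (b :: r) := by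
  have h1 : v + (unitVec a + disp l) - unitVec a = v + disp l := by abel
  have h2 : v + (unitVec b + disp l) - unitVec b = v + disp l := by abel
  have h3 : v + (unitVec b + disp l) + unitVec a = v + (unitVec a + disp l) + unitVec b := by abel
  simp [facet, bwd, fwd, h1, h2, h3]

lemma facet_rotate (v : Fin n → ℤ) (b : Dir n) (r : List (Dir n)) :
    (facet (v + unitVec b) (b :: r.reverse) []).Perm (facet v [] (b :: r)) := by
  have h := cons_facet_perm (v + unitVec b) r.reverse []
  have h1 : v + unitVec b + (unitVec b + disp r) - unitVec b = v + unitVec b + disp r := by abel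
  simp only [facet, bwd, fwd, walk, disp_cons, disp_reverse, disp_nil, add_zero, h1,
    List.reverse_reverse, List.append_nil, List.nil_append] at h ⊢
  exact h

lemma facet_opp (v : Fin n → ℤ) (r : List (Dir n)) :
    facet (-v) [] (r.map opp) = (facet v [] r).map Neg.neg := by
  simp [facet, bwd, fwd_map_opp]

variable (lab : (Fin n → ℤ) → Dir n)

lemma card_filter_lab (v : Fin n → ℤ) (w : List (Dir n)) (c : Dir n) :
    ((Finset.range (w.length + 1)).filter fun j => lab (v + disp (w.take j)) = c).card =
      ((walk v w).map lab).count c := by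
  rw [walk_eq_map, List.map_map, List.count, List.countP_map, Finset.card_def]
  simp only [Finset.filter_val, Finset.range_val, Multiset.range, Multiset.filter_coe,
    Multiset.coe_card, List.countP_eq_length_filter]
  congr 2
  ext j
  simp [Function.comp_def, beq_eq_decide]

/-- A simplex with base point `v` and steps `l.reverse ++ r`, together with a distinguished vertex
between `l` and `r`, is admissible if it lies in the cone spanned by its steps and in the cube of
radius `N`, and the labels of the remaining vertices are exactly its steps. -/
structure Admissible (N : ℤ) (v : Fin n → ℤ) (l r : List (Dir n)) : Prop where
  nodup : ((l ++ r).map Prod.fst).Nodup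
  zero : ∀ i ∉ (l ++ r).map Prod.fst, v i = 0
  low : ∀ a ∈ l ++ r, 0 ≤ a.2 * v a.1
  high : ∀ a ∈ l ++ r, a.2 * v a.1 < N
  perm : ((facet v l r).map lab).Perm (l ++ r)

variable {lab} {N : ℤ} {v : Fin n → ℤ} {l r l' r' : List (Dir n)}

lemma Admissible.of_perm (h : Admissible lab N v l r) (hp : (l ++ r).Perm (l' ++ r'))
    (hf : ((facet v l' r').map lab).Perm (l ++ r)) : Admissible lab N v l' r' where
  nodup := ((hp.map _).nodup_iff).1 h.nodup
  zero i hi := h.zero i fun h' => hi (((hp.map _).mem_iff).1 h')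
  low a ha := h.low a (hp.mem_iff.2 ha)
  high a ha := h.high a (hp.mem_iff.2 ha)
  perm := hf.trans hp

lemma Admissible.walk_perm (h : Admissible lab N v l r) :
    ((walk v (l.reverse ++ r)).map lab).Perm (lab (v + disp l) :: (l ++ r)) :=
  (((cons_facet_perm v l r).map lab).symm).trans (by simpa using h.perm)

lemma mul_add_unitVec_self (b : Dir n) (v : Fin n → ℤ) :
    (b.2 : ℤ) * (v + unitVec b) b.1 = b.2 * v b.1 + 1 := by
  simp [unitVec_apply_self, mul_add]

lemma mul_sub_unitVec_self (b : Dir n) (v : Fin n → ℤ) :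
    (b.2 : ℤ) * (v - unitVec b) b.1 = b.2 * v b.1 - 1 := by
  simp [unitVec_apply_self, mul_sub]

lemma Admissible.rotate {b : Dir n} (h : Admissible lab N v [] (b :: r))
    (hb : b.2 * v b.1 + 1 < N) : Admissible lab N (v + unitVec b) (b :: r.reverse) [] := by
  obtain ⟨h1, h2, h3, h4, h5⟩ := h
  have hp : (b :: r.reverse ++ []).Perm ([] ++ b :: r) := by
    simp
  have hne : ∀ a ∈ r, b.1 ≠ a.1 := by
    intro a ha hab
    simp only [List.nil_append, List.map_cons, List.nodup_cons] at h1
    exact h1.1 (hab ▸ List.mem_map_of_mem ha)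
  refine ⟨((hp.map _).nodup_iff).2 h1, fun i hi => ?_, fun a ha => ?_, fun a ha => ?_,
    ((facet_rotate v b r).map lab).trans (h5.trans hp.symm)⟩
  · have hi' : i ∉ ([] ++ b :: r).map Prod.fst := fun h' => hi (((hp.map _).mem_iff).2 h')
    have : b.1 ≠ i := by
      rintro rfl
      simp at hi'
    simp [h2 i hi', unitVec_apply_of_ne this]
  · have ha' := hp.mem_iff.1 ha
    have := h3 a ha'
    rcases List.mem_cons.1 (by simpa using ha' : a ∈ b :: r) with rfl | har
    · rw [mul_add_unitVec_self]
      omega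
    · simpa [unitVec_apply_of_ne (hne a har)] using this
  · have ha' := hp.mem_iff.1 ha
    have := h4 a ha'
    rcases List.mem_cons.1 (by simpa using ha' : a ∈ b :: r) with rfl | har
    · rwa [mul_add_unitVec_self]
    · simpa [unitVec_apply_of_ne (hne a har)] using this

lemma Admissible.rotate_back {a : Dir n} (h : Admissible lab N v (a :: l) [])
    (ha : 0 < a.2 * v a.1) : Admissible lab N (v - unitVec a) [] (a :: l.reverse) := by
  obtain ⟨h1, h2, h3, h4, h5⟩ := h
  have hp : ([] ++ a :: l.reverse).Perm (a :: l ++ []) := by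
    simp
  have hne : ∀ b ∈ l, a.1 ≠ b.1 := by
    intro b hb hab
    simp only [List.append_nil, List.map_cons, List.nodup_cons] at h1
    exact h1.1 (hab ▸ List.mem_map_of_mem hb)
  have hf := facet_rotate (v - unitVec a) a l.reverse
  rw [sub_add_cancel, List.reverse_reverse] at hf
  refine ⟨((hp.map _).nodup_iff).2 h1, fun i hi => ?_, fun b hb => ?_, fun b hb => ?_,
    (hf.symm.map lab).trans (h5.trans hp.symm)⟩
  · have hi' : i ∉ (a :: l ++ []).map Prod.fst := fun h' => hi (((hp.map _).mem_iff).2 h')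
    have : a.1 ≠ i := by
      rintro rfl
      simp at hi'
    simp [h2 i hi', unitVec_apply_of_ne this]
  · have hb' := hp.mem_iff.1 hb
    have := h3 b hb'
    rcases List.mem_cons.1 (by simpa using hb' : b ∈ a :: l) with rfl | hbl
    · rw [mul_sub_unitVec_self]
      omega
    · simpa [unitVec_apply_of_ne (hne b hbl)] using this
  · have hb' := hp.mem_iff.1 hb
    have := h4 b hb'
    rcases List.mem_cons.1 (by simpa using hb' : b ∈ a :: l) with rfl | hbl
    · rw [mul_sub_unitVec_self]
      omega
    · simpa [unitVec_apply_of_ne (hne b hbl)] using this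

lemma Admissible.antipode {b : Dir n} (h : Admissible lab N v [] (b :: r))
    (hb : N ≤ b.2 * v b.1 + 1) (hodd : ∀ x i, N ≤ |x i| → lab (-x) = opp (lab x)) :
    Admissible lab N (-v) [] ((b :: r).map opp) := by
  obtain ⟨h1, h2, h3, h4, h5⟩ := h
  have hfst : ((b :: r).map opp).map Prod.fst = (b :: r).map Prod.fst := by
    simp [Function.comp_def]
  simp only [List.nil_append] at h1 h2 h3 h4 h5
  refine ⟨by rwa [List.nil_append, hfst], fun i hi => ?_, fun a ha => ?_, fun a ha => ?_, ?_⟩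
  · rw [List.nil_append, hfst] at hi
    simp [h2 i hi]
  · obtain ⟨c, hc, rfl⟩ := List.mem_map.1 ha
    simpa using h3 c hc
  · obtain ⟨c, hc, rfl⟩ := List.mem_map.1 ha
    simpa using h4 c hc
  · rw [facet_opp, List.nil_append, List.map_map]
    have : (facet v [] (b :: r)).map (lab ∘ Neg.neg) =
        ((facet v [] (b :: r)).map lab).map opp := by
      rw [List.map_map]
      refine List.map_congr_left fun x hx => hodd x b.1 ?_
      simp only [facet, bwd, disp_nil, add_zero, List.nil_append, fwd, List.mem_cons] at hx
      have hxb : x b.1 = (v + unitVec b) b.1 := by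
        rcases hx with rfl | hx
        · rfl
        · exact apply_eq_of_mem_fwd hx (List.nodup_cons.1 h1).1
      rw [hxb]
      refine (hb.trans (mul_add_unitVec_self b v).ge).trans ((le_abs_self _).trans ?_)
      rw [abs_mul]
      rcases Int.units_eq_one_or b.2 with h | h <;> simp [h]
    rw [this]
    exact h5.map opp

/-- Exchange a simplex for the other simplex sharing the facet opposite to the distinguished
vertex, or for the antipodal one if that facet lies on the boundary of the cube. -/
def pivot (N : ℤ) : (Fin n → ℤ) × List (Dir n) × List (Dir n) →
    (Fin n → ℤ) × List (Dir n) × List (Dir n)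
  | (v, a :: l, b :: r) => (v, b :: l, a :: r)
  | (v, [], b :: r) =>
    if b.2 * v b.1 + 1 < N then (v + unitVec b, b :: r.reverse, [])
    else (-v, [], (b :: r).map opp)
  | (v, a :: l, []) =>
    if 0 < a.2 * v a.1 then (v - unitVec a, [], a :: l.reverse) else (v, a :: l, [])
  | (v, [], []) => (v, [], [])

lemma Admissible.pivot {s : (Fin n → ℤ) × List (Dir n) × List (Dir n)}
    (h : Admissible lab N s.1 s.2.1 s.2.2) (hodd : ∀ x i, N ≤ |x i| → lab (-x) = opp (lab x)) :
    Admissible lab N (pivot N s).1 (pivot N s).2.1 (pivot N s).2.2 := by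
  obtain ⟨v, _ | ⟨a, l⟩, _ | ⟨b, r⟩⟩ := s
  · exact h
  · by_cases hb : b.2 * v b.1 + 1 < N
    · simpa [Tucker.pivot, hb] using h.rotate hb
    · simpa [Tucker.pivot, hb] using h.antipode (not_lt.1 hb) hodd
  · by_cases ha : 0 < a.2 * v a.1
    · simpa [Tucker.pivot, ha] using h.rotate_back ha
    · simpa [Tucker.pivot, ha] using h
  · refine h.of_perm ?_ ?_
    · simp only [List.cons_append]
      refine (List.Perm.cons _ List.perm_middle).trans ((List.Perm.swap _ _ _).trans ?_)
      exact List.Perm.cons _ List.perm_middle.symm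
    · simpa only [Tucker.pivot, facet_swap] using h.perm

lemma Admissible.pivot_pivot {s : (Fin n → ℤ) × List (Dir n) × List (Dir n)}
    (h : Admissible lab N s.1 s.2.1 s.2.2) : Tucker.pivot N (Tucker.pivot N s) = s := by
  obtain ⟨v, _ | ⟨a, l⟩, _ | ⟨b, r⟩⟩ := s
  · rfl
  · by_cases hb : b.2 * v b.1 + 1 < N
    · have := h.low b (by simp)
      have h' : 0 < b.2 * (v + unitVec b) b.1 := by
        rw [mul_add_unitVec_self]
        exact Int.lt_add_one_of_le this
      simp only [Tucker.pivot, if_pos hb, if_pos h']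
      simp
    · simp [Tucker.pivot, hb, Function.comp_def]
  · by_cases ha : 0 < a.2 * v a.1
    · have := h.high a (by simp)
      have h' : a.2 * (v - unitVec a) a.1 + 1 < N := by
        rw [mul_sub_unitVec_self]
        simpa using this
      simp only [Tucker.pivot, if_pos ha, if_pos h']
      simp
    · simp [Tucker.pivot, ha]
  · rfl

lemma Admissible.eq_of_pivot_eq {s : (Fin n → ℤ) × List (Dir n) × List (Dir n)}
    (h : Admissible lab N s.1 s.2.1 s.2.2) (hs : Tucker.pivot N s = s) :
    s = (0, [], []) ∨ ∃ v a l, s = (v, a :: l, []) ∧ v a.1 = 0 := by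
  obtain ⟨v, _ | ⟨a, l⟩, _ | ⟨b, r⟩⟩ := s
  · left
    have : v = 0 := funext fun i => h.zero i (by simp)
    rw [this]
  · exfalso
    by_cases hb : b.2 * v b.1 + 1 < N
    · simp [Tucker.pivot, hb] at hs
    · simp only [Tucker.pivot, if_neg hb, Prod.mk.injEq, List.map_cons, List.cons.injEq,
        true_and] at hs
      have := congrArg (fun a : Dir n => (a.2 : ℤ)) hs.2.1
      rcases Int.units_eq_one_or b.2 with h | h <;> simp [h] at this
  · right
    refine ⟨v, a, l, rfl, ?_⟩
    by_cases ha : 0 < a.2 * v a.1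
    · simp [Tucker.pivot, ha] at hs
    · have := le_antisymm (not_lt.1 ha) (h.low a (by simp))
      simpa using this
  · exfalso
    simp only [Tucker.pivot, Prod.mk.injEq, List.cons.injEq, and_true, true_and] at hs
    have := h.nodup
    simp [hs.1] at this

lemma finite_admissible (lab : (Fin n → ℤ) → Dir n) (N : ℤ) :
    {s : (Fin n → ℤ) × List (Dir n) × List (Dir n) |
      Admissible lab N s.1 s.2.1 s.2.2}.Finite := by
  have hl : {l : List (Dir n) | l.Nodup}.Finite :=
    (List.finite_length_le (Dir n) (Fintype.card (Dir n))).subset fun _ h => h.length_le_card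
  refine ((Set.finite_Icc (fun _ => -|N|) (fun _ => |N|)).prod (hl.prod hl)).subset ?_
  rintro ⟨v, l, r⟩ h
  have hn := List.nodup_append.1 h.nodup.of_map
  have hv : ∀ i, |v i| ≤ |N| := by
    intro i
    by_cases hi : i ∈ (l ++ r).map Prod.fst
    · obtain ⟨a, ha, rfl⟩ := List.mem_map.1 hi
      have h1 := h.low a ha
      have h2 := h.high a ha
      have h3 : |(a.2 : ℤ) * v a.1| = |v a.1| := by
        rw [abs_mul]
        rcases Int.units_eq_one_or a.2 with h | h <;> simp [h]
      rw [← h3, abs_of_nonneg h1]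
      exact h2.le.trans (le_abs_self _)
    · rw [show v i = 0 from h.zero i hi, abs_zero]
      exact abs_nonneg N
  exact ⟨⟨fun i => (abs_le.1 (hv i)).1, fun i => (abs_le.1 (hv i)).2⟩, hn.1, hn.2.1⟩

lemma even_card_of_involution {α : Type*} {s : Finset α} (g : α → α) (hg : ∀ a ∈ s, g a ∈ s)
    (hne : ∀ a ∈ s, g a ≠ a) (hgg : ∀ a ∈ s, g (g a) = a) : Even s.card := by
  rw [← ZMod.natCast_eq_zero_iff_even, Finset.card_eq_sum_ones, Nat.cast_sum]
  exact Finset.sum_involution (fun a _ => g a) (fun _ _ => CharTwo.add_self_eq_zero _) (fun a ha _ => hne a ha)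
    hg hgg

lemma perm_of_reverse_append_eq {l r l' r' : List (Dir n)}
    (hw : l'.reverse ++ r' = l.reverse ++ r) : (l ++ r).Perm (l' ++ r') :=
  ((List.reverse_perm l).append_right r).symm.trans
    (hw ▸ (List.reverse_perm l').append_right r')

lemma Admissible.move (h : Admissible lab N v l r) (hw : l'.reverse ++ r' = l.reverse ++ r)
    (hlab : lab (v + disp l') = lab (v + disp l)) : Admissible lab N v l' r' := by
  refine h.of_perm (perm_of_reverse_append_eq hw) ?_
  have := ((cons_facet_perm v l' r').map lab).trans (hw ▸ h.walk_perm)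
  rw [List.map_cons, hlab] at this
  exact this.cons_inv

lemma Admissible.lab_eq (h : Admissible lab N v l r) (h' : Admissible lab N v l' r')
    (hw : l'.reverse ++ r' = l.reverse ++ r) : lab (v + disp l') = lab (v + disp l) := by
  have h1 := h'.walk_perm.symm.trans (hw ▸ h.walk_perm)
  have h2 := h1.trans ((perm_of_reverse_append_eq hw).cons _)
  rw [← Multiset.coe_eq_coe, ← Multiset.cons_coe, ← Multiset.cons_coe] at h2
  exact (Multiset.cons_inj_left _).1 h2

lemma Admissible.card_filter (h : Admissible lab N v l r) :
    ((Finset.range ((l.reverse ++ r).length + 1)).filter fun j =>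
      lab (v + disp ((l.reverse ++ r).take j)) = lab (v + disp l)).card =
      (l ++ r).count (lab (v + disp l)) + 1 := by
  rw [card_filter_lab, h.walk_perm.count_eq, List.count_cons_self]

lemma even_card_filter_mem {P : Finset ((Fin n → ℤ) × List (Dir n) × List (Dir n))}
    (hP : ∀ s, s ∈ P ↔ Admissible lab N s.1 s.2.1 s.2.2) :
    Even (P.filter fun s => lab (s.1 + disp s.2.1) ∈ s.2.1 ++ s.2.2).card := by
  classical
  set Q := P.filter fun s => lab (s.1 + disp s.2.1) ∈ s.2.1 ++ s.2.2
  let key : (Fin n → ℤ) × List (Dir n) × List (Dir n) → (Fin n → ℤ) × List (Dir n) :=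
    fun s => (s.1, s.2.1.reverse ++ s.2.2)
  rw [Finset.card_eq_sum_card_image key Q]
  refine Finset.even_sum _ fun k hk => ?_
  obtain ⟨⟨v, l, r⟩, hs, rfl⟩ := Finset.mem_image.1 hk
  obtain ⟨hs, hmem⟩ := Finset.mem_filter.1 hs
  have h : Admissible lab N v l r := (hP _).1 hs
  have hcard := h.card_filter
  rw [List.count_eq_one_of_mem h.nodup.of_map hmem, one_add_one_eq_two] at hcard
  have : (Q.filter fun s => key s = key (v, l, r)).card = 2 := by
    rw [← hcard]
    symm
    set w := l.reverse ++ r with hw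
    refine Finset.card_bij (fun j _ => (v, (w.take j).reverse, w.drop j)) ?_ ?_ ?_
    · intro j hj
      obtain ⟨-, hj⟩ := Finset.mem_filter.1 hj
      have hwj : (w.take j).reverse.reverse ++ w.drop j = l.reverse ++ r := by simp [hw]
      have hlab : lab (v + disp (w.take j).reverse) = lab (v + disp l) := by simpa using hj
      simp only [Q, Finset.mem_filter, hP]
      refine ⟨⟨h.move hwj hlab, ?_⟩, by simp [key, hw]⟩
      rw [hlab]
      exact (perm_of_reverse_append_eq hwj).mem_iff.1 hmem
    · intro i hi j hj hij
      simp only [Finset.mem_filter, Finset.mem_range] at hi hj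
      have := congrArg (fun s => s.2.1.length) hij
      simp only [List.length_reverse, List.length_take] at this
      omega
    · rintro ⟨v', l', r'⟩ hs'
      simp only [Q, Finset.mem_filter, hP, key, Prod.mk.injEq] at hs'
      obtain ⟨⟨h', -⟩, rfl, hw'⟩ := hs'
      have hlab := h.lab_eq h' hw'
      refine ⟨l'.length, ?_, ?_⟩
      · simp only [Finset.mem_filter, Finset.mem_range, hw, ← hw']
        simp only [List.length_append, List.length_reverse]
        refine ⟨by omega, ?_⟩
        rw [List.take_left' (by simp), disp_reverse, hlab]
      · rw [hw, ← hw', List.take_left' (by simp), List.drop_left' (by simp), List.reverse_reverse]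
  rw [this]
  exact even_two

lemma Admissible.fst_notMem (h : Admissible lab N v l r)
    (hne : ∀ x y, (∀ i, |x i - y i| ≤ 1) → lab x ≠ opp (lab y))
    (hmem : lab (v + disp l) ∉ l ++ r) : (lab (v + disp l)).1 ∉ (l ++ r).map Prod.fst := by
  intro hc
  obtain ⟨a, ha, hac⟩ := List.mem_map.1 hc
  rcases eq_or_eq_opp hac with rfl | hopp
  · exact hmem ha
  · obtain ⟨x, hx, rfl⟩ := List.mem_map.1 (h.perm.mem_iff.2 ha)
    have hw : ((l.reverse ++ r).map Prod.fst).Nodup :=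
      ((((List.reverse_perm l).append_right r).map _).nodup_iff).2 h.nodup
    exact hne x (v + disp l) (abs_sub_le_of_mem_walk hw
      ((cons_facet_perm v l r).subset (List.mem_cons_of_mem _ hx))
      ((cons_facet_perm v l r).subset List.mem_cons_self)) hopp

lemma Admissible.extend (h : Admissible lab N v l r) (hN : 0 < N)
    (hc : (lab (v + disp l)).1 ∉ (l ++ r).map Prod.fst) :
    Admissible lab N v (lab (v + disp l) :: (r.reverse ++ l)) [] := by
  set c := lab (v + disp l) with hcdef
  have hp : (r.reverse ++ l).Perm (l ++ r) :=
    List.perm_append_comm.trans ((List.reverse_perm r).append_left l)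
  have hp' : (c :: (r.reverse ++ l) ++ []).Perm (c :: (l ++ r)) := by simpa using hp
  have hvc : v c.1 = 0 := h.zero _ hc
  have hf : (facet v (c :: (r.reverse ++ l)) []).Perm (walk v (l.reverse ++ r)) := by
    have h1 := cons_facet_perm v (r.reverse ++ l) []
    have h2 : v + (unitVec c + (disp r + disp l)) - unitVec c = v + (disp r + disp l) := by abel
    simpa [facet, bwd, fwd, h2] using h1
  refine ⟨((hp'.map _).nodup_iff).2 ?_, fun i hi => ?_, fun a ha => ?_, fun a ha => ?_, ?_⟩
  · rw [List.map_cons, List.nodup_cons]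
    exact ⟨hc, h.nodup⟩
  · refine h.zero i fun h' => hi (((hp'.map _).mem_iff).2 ?_)
    rw [List.map_cons]
    exact List.mem_cons_of_mem _ h'
  · rcases List.mem_cons.1 (hp'.mem_iff.1 ha) with rfl | ha
    · simp [hvc]
    · exact h.low a ha
  · rcases List.mem_cons.1 (hp'.mem_iff.1 ha) with rfl | ha
    · simpa [hvc] using hN
    · exact h.high a ha
  · exact (hf.map lab).trans (h.walk_perm.trans hp'.symm)

lemma Admissible.exists_extend {a : Dir n} (h : Admissible lab N v (a :: l) []) (hv : v a.1 = 0) :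
    ∃ l' r', Admissible lab N v l' r' ∧ lab (v + disp l') = a ∧ r'.reverse ++ l' = l := by
  have hf : (facet v (a :: l) []).Perm (walk v l.reverse) := by
    have h1 := cons_facet_perm v l []
    have h2 : v + (unitVec a + disp l) - unitVec a = v + disp l := by abel
    simpa [facet, bwd, fwd, h2] using h1
  have hwalk : ((walk v l.reverse).map lab).Perm (a :: l) :=
    (hf.symm.map lab).trans (by simpa using h.perm)
  obtain ⟨x, hx, hxa⟩ := List.mem_map.1 (hwalk.mem_iff.2 List.mem_cons_self)
  obtain ⟨j, -, rfl⟩ := mem_walk.1 hx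
  have hl : ((l.reverse.drop j).reverse ++ (l.reverse.take j).reverse) = l := by
    rw [← List.reverse_append, List.take_append_drop, List.reverse_reverse]
  have hlab : lab (v + disp (l.reverse.take j).reverse) = a := by simpa using hxa
  have hp : ((l.reverse.take j).reverse ++ l.reverse.drop j).Perm l :=
    ((List.reverse_perm _).append_right _).trans
      (by rw [List.take_append_drop]; exact List.reverse_perm l)
  refine ⟨(l.reverse.take j).reverse, l.reverse.drop j, ?_, hlab, hl⟩
  have hnd : ((a :: l).map Prod.fst).Nodup := by simpa using h.nodup
  rw [List.map_cons, List.nodup_cons] at hnd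
  refine ⟨((hp.map _).nodup_iff).2 hnd.2, fun i hi => ?_, fun b hb => ?_, fun b hb => ?_, ?_⟩
  · by_cases hia : i = a.1
    · rw [hia, hv]
    · refine h.zero i fun h' => hi (((hp.map _).mem_iff).2 ?_)
      rw [List.append_nil, List.map_cons] at h'
      exact (List.mem_cons.1 h').resolve_left hia
  · exact h.low b (by simp [hp.mem_iff.1 hb])
  · exact h.high b (by simp [hp.mem_iff.1 hb])
  · have h1 := (cons_facet_perm v (l.reverse.take j).reverse (l.reverse.drop j)).map lab
    rw [List.map_cons, hlab, List.reverse_reverse, List.take_append_drop] at h1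
    exact (h1.trans hwalk).cons_inv.trans hp.symm

lemma Admissible.eq_of_extend_eq (h : Admissible lab N v l r)
    (hmem : lab (v + disp l) ∉ l ++ r) (hlab : lab (v + disp l') = lab (v + disp l))
    (hw : r'.reverse ++ l' = r.reverse ++ l) : l' = l ∧ r' = r := by
  have hw' : l'.reverse ++ r' = l.reverse ++ r := by
    simpa using congrArg List.reverse hw
  have hcard := h.card_filter
  rw [List.count_eq_zero_of_not_mem hmem, zero_add] at hcard
  have hlen : l'.length = l.length := by
    refine Finset.card_le_one.1 hcard.le _ ?_ _ ?_
    · simp only [Finset.mem_filter, Finset.mem_range, ← hw']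
      refine ⟨by simp only [List.length_append, List.length_reverse]; omega, ?_⟩
      rw [List.take_left' (by simp), disp_reverse, hlab]
    · simp only [Finset.mem_filter, Finset.mem_range]
      refine ⟨by simp only [List.length_append, List.length_reverse]; omega, ?_⟩
      rw [List.take_left' (by simp), disp_reverse]
  obtain ⟨h1, h2⟩ := List.append_inj hw' (by simpa using hlen)
  exact ⟨List.reverse_injective h1, h2⟩

/-- **Tucker's lemma** for the cube of radius `N` in `ℤⁿ`: a labelling by signed coordinates which
is antipodal on and outside the boundary has a complementary pair of adjacent points. -/
theorem exists_complementary (hN : 0 < N) (hodd : ∀ x i, N ≤ |x i| → lab (-x) = opp (lab x)) :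
    ∃ x y, (∀ i, |x i - y i| ≤ 1) ∧ lab x = opp (lab y) := by
  classical
  by_contra! hne
  set P := (finite_admissible lab N).toFinset
  have hP : ∀ s, s ∈ P ↔ Admissible lab N s.1 s.2.1 s.2.2 := fun s => by simp [P]
  have hA := even_card_filter_mem hP
  have hB : Even (P.filter fun s => ¬ pivot N s = s).card := by
    refine even_card_of_involution (pivot N) (fun s hs => ?_)
      (fun s hs => (Finset.mem_filter.1 hs).2)
      (fun s hs => ((hP s).1 (Finset.mem_filter.1 hs).1).pivot_pivot)
    obtain ⟨hs, hsne⟩ := Finset.mem_filter.1 hs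
    have h := (hP s).1 hs
    exact Finset.mem_filter.2 ⟨(hP _).2 (h.pivot hodd), by rwa [h.pivot_pivot, eq_comm]⟩
  have hroot : ((0, [], []) : (Fin n → ℤ) × List (Dir n) × List (Dir n)) ∈
      P.filter fun s => pivot N s = s := by
    refine Finset.mem_filter.2 ⟨(hP _).2 ⟨?_, ?_, ?_, ?_, ?_⟩, rfl⟩ <;> simp [facet, bwd, fwd]
  have hC : (P.filter fun s => ¬ lab (s.1 + disp s.2.1) ∈ s.2.1 ++ s.2.2).card =
      ((P.filter fun s => pivot N s = s).erase (0, [], [])).card := by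
    refine Finset.card_bij
      (fun s _ => (s.1, lab (s.1 + disp s.2.1) :: (s.2.2.reverse ++ s.2.1), [])) ?_ ?_ ?_
    · rintro ⟨v, l, r⟩ hs
      obtain ⟨hs, hmem⟩ := Finset.mem_filter.1 hs
      have h : Admissible lab N v l r := (hP _).1 hs
      have hc := h.fst_notMem hne hmem
      refine Finset.mem_erase.2 ⟨by simp, Finset.mem_filter.2 ⟨(hP _).2 (h.extend hN hc), ?_⟩⟩
      simp [pivot, h.zero _ hc]
    · rintro ⟨v, l, r⟩ hs ⟨v', l', r'⟩ - heq
      obtain ⟨hs, hmem⟩ := Finset.mem_filter.1 hs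
      simp only [Prod.mk.injEq, List.cons.injEq, and_true] at heq
      obtain ⟨rfl, hlab, hw⟩ := heq
      have h : Admissible lab N v l r := (hP _).1 hs
      obtain ⟨rfl, rfl⟩ := h.eq_of_extend_eq hmem hlab.symm hw.symm
      rfl
    · intro s hs
      obtain ⟨hs0, hs⟩ := Finset.mem_erase.1 hs
      obtain ⟨hs, hfix⟩ := Finset.mem_filter.1 hs
      have h := (hP s).1 hs
      obtain ⟨v, a, l, rfl, hv⟩ := (h.eq_of_pivot_eq hfix).resolve_left hs0
      obtain ⟨l', r', h', hlab, hl⟩ := Admissible.exists_extend h hv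
      refine ⟨(v, l', r'), Finset.mem_filter.2 ⟨(hP _).2 h', ?_⟩, by simp [hlab, hl]⟩
      have hnd : (a :: l).Nodup := by simpa using h.nodup.of_map
      have ha := (List.nodup_cons.1 hnd).1
      rw [← hl] at ha
      simp only [hlab]
      simpa [or_comm] using ha
  have h1 := P.card_filter_add_card_filter_not fun s => lab (s.1 + disp s.2.1) ∈ s.2.1 ++ s.2.2
  have h2 := P.card_filter_add_card_filter_not fun s => pivot N s = s
  have h3 := Finset.card_erase_add_one hroot
  obtain ⟨a, ha⟩ := hA
  obtain ⟨b, hb⟩ := hB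
  omega

end Tucker

/-- The nearest point of `[-1, 1]`. -/
def clampUnit (t : ℝ) : ℝ := max (-1) (min 1 t)

lemma clampUnit_neg (t : ℝ) : clampUnit (-t) = -clampUnit t := by
  unfold clampUnit
  grind

lemma abs_clampUnit_le (t : ℝ) : |clampUnit t| ≤ 1 := by
  unfold clampUnit
  grind

lemma abs_clampUnit_of_one_le {t : ℝ} (ht : 1 ≤ |t|) : |clampUnit t| = 1 := by
  unfold clampUnit
  grind

lemma abs_clampUnit_sub_le (s t : ℝ) : |clampUnit s - clampUnit t| ≤ |s - t| := by
  unfold clampUnit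
  grind

/-- A coordinate of absolute value at least `δ`, with its sign. -/
noncomputable def signedCoord {n : ℕ} [Nonempty (Fin n)] (δ : ℝ) (y : Fin n → ℝ) : Tucker.Dir n :=
  (Classical.epsilon fun i => δ ≤ |y i|,
    if 0 ≤ y (Classical.epsilon fun i => δ ≤ |y i|) then 1 else -1)

lemma le_abs_signedCoord {n : ℕ} [Nonempty (Fin n)] {δ : ℝ} (hδ : 0 < δ) {y : Fin n → ℝ}
    (hy : δ ≤ ‖y‖) : δ ≤ |y (signedCoord δ y).1| := by
  refine Classical.epsilon_spec (p := fun i => δ ≤ |y i|) ?_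
  by_contra! h
  exact hy.not_gt ((pi_norm_lt_iff hδ).2 h)

lemma le_signedCoord {n : ℕ} [Nonempty (Fin n)] {δ : ℝ} (hδ : 0 < δ) {y : Fin n → ℝ}
    (hy : δ ≤ ‖y‖) : δ ≤ (signedCoord δ y).2 * y (signedCoord δ y).1 := by
  have h := le_abs_signedCoord hδ hy
  by_cases h0 : 0 ≤ y (signedCoord δ y).1
  · have : (signedCoord δ y).2 = 1 := if_pos h0
    simpa [this, abs_of_nonneg h0] using h
  · have : (signedCoord δ y).2 = -1 := if_neg h0
    simpa [this, abs_of_neg (not_le.1 h0)] using h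

lemma signedCoord_neg {n : ℕ} [Nonempty (Fin n)] {δ : ℝ} (hδ : 0 < δ) {y : Fin n → ℝ}
    (hy : δ ≤ ‖y‖) : signedCoord δ (-y) = Tucker.opp (signedCoord δ y) := by
  have h1 : (signedCoord δ (-y)).1 = (signedCoord δ y).1 := by simp [signedCoord]
  rcases Tucker.eq_or_eq_opp h1 with h | h
  · have h2 := le_signedCoord hδ hy
    have h3 := le_signedCoord (y := -y) hδ (by simpa using hy)
    rw [h, Pi.neg_apply, mul_neg] at h3
    linarith
  · exact h

/-- A continuous map on `ℝⁿ` which is odd on the boundary of the unit cube has a zero: a form of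
the **Borsuk–Ulam theorem**. -/
theorem exists_eq_zero_of_odd_on_sphere {n : ℕ} {h : (Fin n → ℝ) → Fin n → ℝ} (hc : Continuous h)
    (hodd : ∀ x, ‖x‖ = 1 → h (-x) = -h x) : ∃ x, h x = 0 := by
  rcases isEmpty_or_nonempty (Fin n) with he | hn
  · exact ⟨0, Subsingleton.elim _ _⟩
  by_contra! hne
  have hK : IsCompact (Metric.closedBall (0 : Fin n → ℝ) 1) := isCompact_closedBall _ _
  obtain ⟨x₀, -, hx₀⟩ := hK.exists_isMinOn ⟨0, by simp⟩ hc.norm.continuousOn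
  set δ := ‖h x₀‖ with hδdef
  have hδ : 0 < δ := norm_pos_iff.2 (hne x₀)
  obtain ⟨ε, hε, hunif⟩ := Metric.uniformContinuousOn_iff.1
    (hK.uniformContinuousOn_of_continuous hc.continuousOn) δ hδ
  obtain ⟨N, hN⟩ := exists_nat_one_div_lt hε
  have hN0 : (0 : ℝ) < N + 1 := by positivity
  let c : (Fin n → ℤ) → Fin n → ℝ := fun x i => clampUnit (x i / (N + 1))
  have hcn : ∀ x, ‖c x‖ ≤ 1 := fun x =>
    (pi_norm_le_iff_of_nonneg zero_le_one).2 fun i => abs_clampUnit_le _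
  have hcK : ∀ x, c x ∈ Metric.closedBall (0 : Fin n → ℝ) 1 := fun x => by simpa using hcn x
  have hcδ : ∀ x, δ ≤ ‖h (c x)‖ := fun x => hx₀ (hcK x)
  obtain ⟨x, y, hxy, hlab⟩ := Tucker.exists_complementary
    (lab := fun x => signedCoord δ (h (c x))) (N := (N : ℤ) + 1) (by positivity) (by
      intro x i hi
      have hneg : c (-x) = -c x := by
        ext j
        simp [c, neg_div, clampUnit_neg]
      have h1 : |clampUnit ((x i : ℝ) / (N + 1))| = 1 := by
        refine abs_clampUnit_of_one_le ?_
        rw [abs_div, abs_of_pos hN0, le_div_iff₀ hN0, one_mul]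
        exact_mod_cast hi
      have hnorm : ‖c x‖ = 1 := le_antisymm (hcn x) (h1.ge.trans (norm_le_pi_norm (c x) i))
      simp only [hneg, hodd _ hnorm]
      exact signedCoord_neg hδ (hcδ x))
  have hdist : dist (c x) (c y) < ε := by
    refine ((dist_pi_le_iff (by positivity)).2 fun i => ?_).trans_lt hN
    refine (abs_clampUnit_sub_le _ _).trans ?_
    rw [← sub_div, abs_div, abs_of_pos hN0]
    gcongr
    exact_mod_cast hxy i
  have h1 := hunif _ (hcK x) _ (hcK y) hdist
  have h2 := le_signedCoord hδ (hcδ x)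
  have h3 := le_signedCoord hδ (hcδ y)
  rw [hlab] at h2
  set s := signedCoord δ (h (c y))
  have h4 : |h (c x) s.1 - h (c y) s.1| < δ := (dist_le_pi_dist _ _ s.1).trans_lt h1
  rw [abs_lt] at h4
  rcases Int.units_eq_one_or s.2 with hs | hs <;> simp [hs] at h2 h3 <;> linarith

section Halfspace

variable {E : Type*} [NormedAddCommGroup E] [InnerProductSpace ℝ E]
  [MeasurableSpace E] [BorelSpace E]

lemma measurableSet_halfspace_s2 (a : E) (b : ℝ) : MeasurableSet {x | ⟪a, x⟫ ≤ b} :=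
  (isClosed_le (by fun_prop) continuous_const).measurableSet

variable [FiniteDimensional ℝ E]

lemma ae_inner_ne_s2 {μ : Measure E} (hμ : μ ≪ volume) {a : E} (ha : a ≠ 0) (b : ℝ) :
    ∀ᵐ x ∂μ, ⟪a, x⟫ ≠ b := by
  refine hμ.ae_le ?_
  let s : AffineSubspace ℝ E :=
    (AffineSubspace.mk' b (⊥ : Submodule ℝ ℝ)).comap (innerSL ℝ a).toLinearMap.toAffineMap
  have hs : (s : Set E) = {x | ⟪a, x⟫ = b} := by
    ext x
    simp [s, AffineSubspace.mem_mk', sub_eq_zero]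
  suffices h : volume (s : Set E) = 0 by
    rw [hs] at h
    exact measure_eq_zero_iff_ae_notMem.1 h
  refine Measure.addHaar_affineSubspace _ _ fun htop => ha ?_
  have h : ∀ x, ⟪a, x⟫ = b := fun x => by
    have : x ∈ (s : Set E) := by simp [htop]
    rwa [hs] at this
  have h0 := h 0
  rw [inner_zero_right] at h0
  exact inner_self_eq_zero.1 ((h a).trans h0.symm)

lemma continuousAt_measureReal_halfspace {μ : Measure E} [IsFiniteMeasure μ] (hμ : μ ≪ volume)
    (p : E) {a : E} (ha : a ≠ 0) :
    ContinuousAt (fun a : E => μ.real {x | ⟪a, x⟫ ≤ ⟪a, p⟫}) a := by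
  refine (ENNReal.tendsto_toReal (measure_ne_top _ _)).comp ?_
  refine tendsto_measure_of_ae_tendsto_indicator_of_isFiniteMeasure _
    (measurableSet_halfspace_s2 _ _) (fun a => measurableSet_halfspace_s2 _ _) ?_
  filter_upwards [ae_inner_ne_s2 hμ ha ⟪a, p⟫] with x hx
  have hx1 : ContinuousAt (fun a : E => ⟪a, x⟫) a := by fun_prop
  have hp1 : ContinuousAt (fun a : E => ⟪a, p⟫) a := by fun_prop
  rcases lt_or_gt_of_ne hx with h | h
  · filter_upwards [hx1.eventually_lt hp1 h] with a' ha'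
    exact iff_of_true ha'.le h.le
  · filter_upwards [hp1.eventually_lt hx1 h] with a' ha'
    exact iff_of_false (not_le.2 ha') (not_le.2 h)

lemma measureReal_halfspace_neg {μ : Measure E} [IsProbabilityMeasure μ] (hμ : μ ≪ volume)
    (p : E) {a : E} (ha : a ≠ 0) :
    μ.real {x | ⟪-a, x⟫ ≤ ⟪-a, p⟫} = 1 - μ.real {x | ⟪a, x⟫ ≤ ⟪a, p⟫} := by
  rw [← probReal_compl_eq_one_sub (measurableSet_halfspace_s2 _ _)]
  refine measureReal_congr ?_
  filter_upwards [ae_inner_ne_s2 hμ ha ⟪a, p⟫] with x hx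
  have h : ⟪-a, x⟫ ≤ ⟪-a, p⟫ ↔ ¬ ⟪a, x⟫ ≤ ⟪a, p⟫ := by
    rw [inner_neg_left, inner_neg_left, neg_le_neg_iff, not_le]
    exact hx.symm.le_iff_lt
  exact propext h

end Halfspace

/-- A nowhere vanishing map `ℝⁿ → ℝⁿ⁺¹` which is odd on the unit sphere of the sup norm. -/
noncomputable def upperLift {n : ℕ} (x : Fin n → ℝ) : EuclideanSpace ℝ (Fin (n + 1)) :=
  WithLp.toLp 2 (Fin.cons (1 - ‖x‖) x)

lemma continuous_upperLift {n : ℕ} : Continuous (upperLift (n := n)) := by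
  refine (PiLp.continuous_toLp 2 _).comp (continuous_pi fun i => ?_)
  refine Fin.cases ?_ (fun j => ?_) i
  · simp only [Fin.cons_zero]
    fun_prop
  · simpa using continuous_apply j

lemma upperLift_ne_zero {n : ℕ} (x : Fin n → ℝ) : upperLift x ≠ 0 := by
  intro h
  have h1 : x = 0 := funext fun i => by
    simpa [upperLift] using congrArg (fun y : EuclideanSpace ℝ (Fin (n + 1)) => y i.succ) h
  have h2 : 1 - ‖x‖ = 0 := by
    simpa [upperLift] using congrArg (fun y : EuclideanSpace ℝ (Fin (n + 1)) => y 0) h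
  simp [h1] at h2

lemma upperLift_neg {n : ℕ} {x : Fin n → ℝ} (hx : ‖x‖ = 1) : upperLift (-x) = -upperLift x := by
  ext i
  refine Fin.cases ?_ (fun j => ?_) i <;> simp [upperLift, hx]

/-- If `p` lies in the convex hull of the union of the supports of `d` absolutely continuous
probability measures on `ℝ^d`, then there is a closed halfspace whose boundary hyperplane
contains `p` and which cuts the same fraction of each measure. -/
theorem fraction_cut_through_point (d : ℕ)
    (μ : Fin d → Measure (EuclideanSpace ℝ (Fin d)))
    (habs : ∀ i, μ i ≪ volume) (hprob : ∀ i, IsProbabilityMeasure (μ i))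
    (p : EuclideanSpace ℝ (Fin d))
    (hp : p ∈ convexHull ℝ
      (⋃ i, {x : EuclideanSpace ℝ (Fin d) |
        ∀ U : Set (EuclideanSpace ℝ (Fin d)), IsOpen U → x ∈ U → 0 < μ i U})) :
    ∃ (a : EuclideanSpace ℝ (Fin d)) (b : ℝ), a ≠ 0 ∧ ⟪a, p⟫ = b ∧
      ∀ i j : Fin d, μ i {x | ⟪a, x⟫ ≤ b} = μ j {x | ⟪a, x⟫ ≤ b} := by
  rcases d with _ | n
  · simp at hp
  let G : Fin (n + 1) → EuclideanSpace ℝ (Fin (n + 1)) → ℝ :=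
    fun i a => (μ i).real {x | ⟪a, x⟫ ≤ ⟪a, p⟫}
  have hG : ∀ i, Continuous fun x : Fin n → ℝ => G i (upperLift x) := fun i =>
    continuous_iff_continuousAt.2 fun x =>
      ContinuousAt.comp (f := upperLift) (g := G i)
        (continuousAt_measureReal_halfspace (habs i) p (upperLift_ne_zero x))
        continuous_upperLift.continuousAt
  obtain ⟨x, hx⟩ := exists_eq_zero_of_odd_on_sphere
    (h := fun (x : Fin n → ℝ) i => G i.succ (upperLift x) - G 0 (upperLift x))
    (continuous_pi fun i => (hG _).sub (hG _)) (by
      intro x hx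
      ext i
      simp only [upperLift_neg hx, G, Pi.neg_apply,
        measureReal_halfspace_neg (habs _) p (upperLift_ne_zero x)]
      ring)
  have h0 : ∀ i, G i (upperLift x) = G 0 (upperLift x) := by
    refine Fin.cases rfl fun i => sub_eq_zero.1 (congrFun hx i)
  refine ⟨upperLift x, _, upperLift_ne_zero x, rfl, fun i j => ?_⟩
  exact (measureReal_eq_measureReal_iff).1 ((h0 i).trans (h0 j).symm)
end

section
/- Let 1/(n+1) < α < 1/n, let μ₀ be the uniform probability measure on (0,1), and let μ₁ be a probability measure assigning mass 1/n to each interval Δᵢ of length ε < α − 1/(n+1) centered at i/(n+1), for i = 1,…,n. Then every interval C ⊆ ℝ with μ₀(C) = α contains some Δᵢ entirely, and hence μ₁(C) ≥ 1/n > α. -/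
open MeasureTheory

/-- An order-connected subset of `(0,1)` of length at least `α` contains a closed interval of
length `ε` centered at some `i/(n+1)` with `1 ≤ i ≤ n`, as soon as `1/(n+1) + ε < α`. -/
theorem exists_Icc_grid_subset (n : ℕ) {α ε : ℝ} (hε0 : 0 < ε)
    (hε : ε < α - 1 / ((n : ℝ) + 1)) {D : Set ℝ} (hD : D.OrdConnected)
    (hD01 : D ⊆ Set.Ioo 0 1) (hvol : ENNReal.ofReal α ≤ volume D) :
    ∃ i : ℕ, 1 ≤ i ∧ i ≤ n ∧
      Set.Icc ((i : ℝ) / ((n : ℝ) + 1) - ε / 2) ((i : ℝ) / ((n : ℝ) + 1) + ε / 2) ⊆ D := by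
  have hn : (0 : ℝ) < n + 1 := by positivity
  have hinv : 0 < 1 / ((n : ℝ) + 1) := by positivity
  have hne : D.Nonempty := by
    rw [Set.nonempty_iff_ne_empty]
    rintro rfl
    rw [measure_empty, nonpos_iff_eq_zero, ENNReal.ofReal_eq_zero] at hvol
    linarith
  have hbelow : BddBelow D := ⟨0, fun x hx => (hD01 hx).1.le⟩
  have habove : BddAbove D := ⟨1, fun x hx => (hD01 hx).2.le⟩
  have ha : 0 ≤ sInf D := le_csInf hne fun x hx => (hD01 hx).1.le
  have hb : sSup D ≤ 1 := csSup_le hne fun x hx => (hD01 hx).2.le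
  have hsub : Set.Ioo (sInf D) (sSup D) ⊆ D :=
    IsConnected.Ioo_csInf_csSup_subset ⟨hne, hD.isPreconnected⟩ hbelow habove
  have hlen : α ≤ sSup D - sInf D := by
    have h := hvol.trans (measure_mono (subset_Icc_csInf_csSup hbelow habove))
    rw [Real.volume_Icc] at h
    exact (ENNReal.ofReal_le_ofReal_iff
      (sub_nonneg.2 (csInf_le_csSup hne hbelow habove))).1 h
  generalize sInf D = a at *
  generalize sSup D = b at *
  have hfloor := Nat.floor_le (a := (a + ε / 2) * (n + 1)) (by positivity)
  have hlt := Nat.lt_floor_add_one ((a + ε / 2) * ((n : ℝ) + 1))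
  set k := ⌊(a + ε / 2) * ((n : ℝ) + 1)⌋₊
  have hleft : a + ε / 2 < ((k + 1 : ℕ) : ℝ) / (n + 1) := by
    rw [lt_div_iff₀ hn]
    exact_mod_cast hlt
  have hright : ((k + 1 : ℕ) : ℝ) / (n + 1) < b - ε / 2 := by
    have h : (k : ℝ) / (n + 1) ≤ a + ε / 2 := (div_le_iff₀ hn).2 hfloor
    rw [Nat.cast_add_one, add_div]
    linarith
  refine ⟨k + 1, k.succ_pos, ?_, fun x hx => hsub ⟨?_, ?_⟩⟩
  · have h : ((k + 1 : ℕ) : ℝ) / (n + 1) < 1 := by linarith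
    rw [div_lt_one hn] at h
    exact Nat.lt_succ_iff.1 (by exact_mod_cast h)
  · linarith [hx.1]
  · linarith [hx.2]

/-- The concrete one-dimensional counterexample: with `1/(n+1) < α < 1/n`, `μ₀` uniform on
`(0,1)` and `μ₁` giving mass `1/n` to each of `n` intervals `Δᵢ` of length `ε` centered at
`i/(n+1)`, any interval `C` with `μ₀ C = α` contains some `Δᵢ` entirely, whence
`μ₁ C ≥ 1/n > α`. -/
theorem one_dimensional_counterexample (n : ℕ) (hn : 0 < n) (α ε : ℝ)
    (hα1 : 1 / ((n : ℝ) + 1) < α) (hα2 : α < 1 / (n : ℝ))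
    (hε0 : 0 < ε) (hε : ε < α - 1 / ((n : ℝ) + 1))
    (μ₁ : Measure ℝ) (hprob : IsProbabilityMeasure μ₁)
    (hmass : ∀ i : ℕ, 1 ≤ i → i ≤ n →
      μ₁ (Set.Icc ((i : ℝ) / ((n : ℝ) + 1) - ε / 2) ((i : ℝ) / ((n : ℝ) + 1) + ε / 2)) =
        ENNReal.ofReal (1 / (n : ℝ)))
    (hsupp : μ₁ (⋃ i ∈ Set.Icc 1 n,
      Set.Icc ((i : ℝ) / ((n : ℝ) + 1) - ε / 2) ((i : ℝ) / ((n : ℝ) + 1) + ε / 2))ᶜ = 0) :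
    ∀ C : Set ℝ, Convex ℝ C →
      (volume.restrict (Set.Ioo (0 : ℝ) 1)) C = ENNReal.ofReal α →
      (∃ i : ℕ, 1 ≤ i ∧ i ≤ n ∧
        Set.Icc ((i : ℝ) / ((n : ℝ) + 1) - ε / 2) ((i : ℝ) / ((n : ℝ) + 1) + ε / 2) ⊆ C) ∧
      ENNReal.ofReal (1 / (n : ℝ)) ≤ μ₁ C ∧ ENNReal.ofReal α < μ₁ C := by
  intro C hC hvol
  rw [Measure.restrict_apply' measurableSet_Ioo] at hvol
  obtain ⟨i, hi1, hin, hi⟩ := exists_Icc_grid_subset n hε0 hε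
    (hC.ordConnected.inter Set.ordConnected_Ioo) Set.inter_subset_right hvol.ge
  have hiC := hi.trans Set.inter_subset_left
  have hμ : ENNReal.ofReal (1 / (n : ℝ)) ≤ μ₁ C := hmass i hi1 hin ▸ measure_mono hiC
  exact ⟨⟨i, hi1, hin, hiC⟩, hμ,
    ((ENNReal.ofReal_lt_ofReal_iff (by positivity)).2 hα2).trans_le hμ⟩
end
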